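/- arXiv:1204.3212 — 3 statements merged into one kernel-verified Lean document; each statement's English description precedes it below -/
import Mathlib

section
/- Let A ∈ ℝ^{M×Q}. Then E_w[GSURE^A(y)] = E_w[‖A μ₀ − A μ̂(y)‖₂²], and E_w[tr(A (∂μ̂(y)/∂y) A*)] = DOF^A; that is, GSURE^A is an unbiased estimator of the risk E_w‖A μ₀ − A μ̂(y)‖₂², and tr(A (∂μ̂(y)/∂y) A*) is an unbiased estimator of DOF^A. -/
open Matrix MeasureTheory ProbabilityTheory

/-- The Gaussian measure `N(0, v·Id)` on `ℝ^Q`, as a product of one-dimensional Gaussians. -/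
noncomputable def gaussVec (Q : ℕ) (v : NNReal) : Measure (Fin Q → ℝ) :=
  Measure.pi fun _ => gaussianReal 0 v

/-- The Jacobian matrix of a map `ℝ^Q → ℝ^Q` at a point. -/
noncomputable def jacM {Q : ℕ} (f : (Fin Q → ℝ) → (Fin Q → ℝ)) (y : Fin Q → ℝ) :
    Matrix (Fin Q) (Fin Q) ℝ :=
  LinearMap.toMatrix' (fderiv ℝ f y : (Fin Q → ℝ) →ₗ[ℝ] (Fin Q → ℝ))

/-- The generalized SURE associated to the matrix `A`:
`GSURE^A(y) = ‖A(y − μ̂(y))‖₂² − σ² tr(A*A) + 2σ² tr(A (∂μ̂(y)/∂y) A*)`. -/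
noncomputable def GSURE {M Q : ℕ} (A : Matrix (Fin M) (Fin Q) ℝ) (σ : ℝ)
    (muHat : (Fin Q → ℝ) → (Fin Q → ℝ)) (y : Fin Q → ℝ) : ℝ :=
  ∑ i, (A.mulVec (y - muHat y) i) ^ 2 - σ ^ 2 * (Aᵀ * A).trace
    + 2 * σ ^ 2 * (A * jacM muHat y * Aᵀ).trace

open Filter Topology

lemma gv_pdf_hasDerivAt (v : NNReal) (hv : v ≠ 0) (x : ℝ) :
    HasDerivAt (gaussianPDFReal 0 v) (-(x / v) * gaussianPDFReal 0 v x) x := by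
  have hv' : (v : ℝ) ≠ 0 := by exact_mod_cast hv
  have h1 : HasDerivAt (fun x : ℝ => -(x - 0) ^ 2 / (2 * (v : ℝ))) (-(x / v)) x := by
    have := ((((hasDerivAt_id x).sub_const 0).pow 2).neg).div_const (2 * (v : ℝ))
    refine this.congr_deriv ?_
    simp
    field_simp
  have h2 := (h1.exp).const_mul (Real.sqrt (2 * Real.pi * v))⁻¹
  rw [gaussianPDFReal_def]
  refine h2.congr_deriv ?_
  ring

lemma gv_lip_memLp {E : Type*} [NormedAddCommGroup E] [MeasurableSpace E] [BorelSpace E]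
    (μ : Measure E) [IsFiniteMeasure μ] (h : MemLp (fun w : E => ‖w‖) 2 μ)
    {K : NNReal} {f : E → ℝ} (hf : LipschitzWith K f) : MemLp f 2 μ := by
  have h2 : MemLp (fun w : E => |f 0| + K * ‖w‖) 2 μ := by
    have h3 : MemLp (fun w : E => (K : ℝ) * ‖w‖) 2 μ := h.const_mul (K : ℝ)
    have h4 : MemLp (fun _ : E => |f 0|) 2 μ := memLp_const _
    exact h4.add h3
  refine h2.mono' hf.continuous.aestronglyMeasurable (ae_of_all _ fun w => ?_)
  have := hf.dist_le_mul w 0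
  rw [Real.dist_eq, dist_zero_right] at this
  rw [Real.norm_eq_abs]
  have h3 : |f w| ≤ |f w - f 0| + |f 0| := by
    simpa using abs_add_le (f w - f 0) (f 0)
  linarith

lemma gv_stein_one (v : NNReal) (hv : v ≠ 0) {K : NNReal} {f : ℝ → ℝ} (hf : LipschitzWith K f) :
    ∫ x, x * f x ∂(gaussianReal 0 v) = v * ∫ x, deriv f x ∂(gaussianReal 0 v) := by
  have hv' : (v : ℝ) ≠ 0 := by exact_mod_cast hv
  have hvp : 0 < (v : ℝ) := by positivity
  set p := gaussianPDFReal 0 v with hp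
  have hid : MemLp (fun x : ℝ => x) 2 (gaussianReal 0 v) := memLp_id_gaussianReal' 2 (by simp)
  have hfm : MemLp f 2 (gaussianReal 0 v) := by
    have hn : MemLp (fun x : ℝ => ‖x‖) 2 (gaussianReal 0 v) := hid.norm
    exact gv_lip_memLp (gaussianReal 0 v) hn hf
  have hdens {g : ℝ → ℝ} (hg : Integrable g (gaussianReal 0 v)) : Integrable (fun x => p x * g x) := by
    rw [gaussianReal_of_var_ne_zero _ hv, integrable_withDensity_iff_integrable_smul'
      (measurable_gaussianPDF _ _) (ae_of_all _ fun _ ↦ gaussianPDF_lt_top)] at hg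
    simpa [toReal_gaussianPDF] using hg
  have hd : Integrable (deriv f) (gaussianReal 0 v) :=
    Integrable.of_bound (measurable_deriv f).aestronglyMeasurable K
      (ae_of_all _ fun x => norm_deriv_le_of_lipschitz hf)
  have hxf : Integrable (fun x => x * f x) (gaussianReal 0 v) := hid.integrable_mul hfm
  have hI1 := hdens hxf
  have hI2 := hdens hd
  have hderiv : deriv p = fun x => -(x / v) * p x := funext fun x => (gv_pdf_hasDerivAt v hv x).deriv
  have hpc : ContDiff ℝ 1 p := by
    rw [hp, gaussianPDFReal_def]; fun_prop
  have hpac (a b : ℝ) : AbsolutelyContinuousOnInterval p a b :=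
    ContDiffOn.absolutelyContinuousOnInterval hpc.contDiffOn
  have hfac (a b : ℝ) : AbsolutelyContinuousOnInterval f a b :=
    LipschitzOnWith.absolutelyContinuousOnInterval (hf.lipschitzOnWith (s := _))
  have hibp (n : ℕ) := (hfac (-n) n).integral_mul_deriv_eq_deriv_mul (hpac (-n) n)
  have t1 : Tendsto (fun n : ℕ => (n : ℝ)) atTop atTop := tendsto_natCast_atTop_atTop
  have t2 : Tendsto (fun n : ℕ => -(n : ℝ)) atTop atBot := tendsto_neg_atTop_atBot.comp t1
  have hlim : Tendsto (fun x => f x * p x) (cocompact ℝ) (𝓝 0) := by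
    have ha : 0 < (2 * (v : ℝ))⁻¹ := by positivity
    have l0 := tendsto_rpow_abs_mul_exp_neg_mul_sq_cocompact ha 0
    have l1 := tendsto_rpow_abs_mul_exp_neg_mul_sq_cocompact ha 1
    have l2 := ((l0.const_mul |f 0|).add (l1.const_mul (K : ℝ))).const_mul
      (Real.sqrt (2 * Real.pi * v))⁻¹
    simp only [mul_zero, add_zero] at l2
    refine squeeze_zero_norm (fun x => ?_) l2
    have := hf.dist_le_mul x 0
    rw [Real.dist_eq, dist_zero_right, Real.norm_eq_abs] at this
    have h3 : |f x| ≤ |f x - f 0| + |f 0| := by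
      simpa using abs_add_le (f x - f 0) (f 0)
    have hpx : p x = (Real.sqrt (2 * Real.pi * v))⁻¹ * Real.exp (-(2 * (v : ℝ))⁻¹ * x ^ 2) := by
      rw [hp, gaussianPDFReal_def]
      simp only [sub_zero]
      congr 2
      ring
    have hp0 : 0 ≤ p x := gaussianPDFReal_nonneg _ _ _
    rw [norm_mul, Real.norm_eq_abs, Real.norm_of_nonneg hp0]
    calc |f x| * p x ≤ (|f 0| + K * |x|) * p x := by gcongr; linarith
      _ = _ := by rw [hpx]; simp only [Real.rpow_zero, Real.rpow_one]; ring
  rw [cocompact_eq_atBot_atTop, tendsto_sup] at hlim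
  have L1 : Tendsto (fun n : ℕ => ∫ x in (-(n:ℝ))..n, f x * deriv p x) atTop
      (𝓝 (∫ x, f x * deriv p x)) := by
    refine intervalIntegral_tendsto_integral ?_ t2 t1
    refine (hI1.const_mul (-(1 / (v : ℝ)))).congr (ae_of_all _ fun x => ?_)
    simp only [hderiv]; ring
  have L2 : Tendsto (fun n : ℕ => ∫ x in (-(n:ℝ))..n, deriv f x * p x) atTop
      (𝓝 (∫ x, deriv f x * p x)) := by
    refine intervalIntegral_tendsto_integral ?_ t2 t1
    exact hI2.congr (ae_of_all _ fun x => mul_comm _ _)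
  have L3 := ((hlim.2.comp t1).sub (hlim.1.comp t2)).sub L2
  have E := tendsto_nhds_unique L1 (L3.congr fun n => (hibp n).symm)
  rw [integral_gaussianReal_eq_integral_smul hv, integral_gaussianReal_eq_integral_smul hv]
  simp only [smul_eq_mul]
  have e1 : ∫ x, f x * deriv p x = -(1 / (v : ℝ)) * ∫ x, p x * (x * f x) := by
    rw [← integral_const_mul]
    congr 1; ext x; simp only [hderiv]; ring
  have e2 : ∫ x, deriv f x * p x = ∫ x, p x * deriv f x := by
    congr 1; ext x; ring
  rw [e1, e2] at E
  rw [← hp]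
  generalize ∫ x, p x * (x * f x) = a at E ⊢
  generalize ∫ x, p x * deriv f x = b at E ⊢
  have E2 : 1 / (v : ℝ) * a = b := by linarith
  rw [← E2]
  field_simp

lemma gv_ac (n : ℕ) (v : NNReal) (hv : v ≠ 0) : gaussVec n v ≪ volume := by
  induction n with
  | zero =>
    unfold gaussVec
    rw [volume_pi, Measure.pi_of_empty, Measure.pi_of_empty]
  | succ n ih =>
    have m1 := (measurePreserving_piFinSuccAbove (fun _ : Fin (n+1) => gaussianReal 0 v) 0).symm
    have m2 := (measurePreserving_piFinSuccAbove (fun _ : Fin (n+1) => (volume : Measure ℝ)) 0).symm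
    unfold gaussVec at ih ⊢
    rw [volume_pi, ← m1.map_eq, ← m2.map_eq]
    refine Measure.AbsolutelyContinuous.map ?_ (MeasurableEquiv.measurable _)
    exact (gaussianReal_absolutelyContinuous 0 hv).prod ih

instance gv_prob (n : ℕ) (v : NNReal) : IsProbabilityMeasure (gaussVec n v) := by
  unfold gaussVec; infer_instance

lemma gv_coord_memLp (n : ℕ) (v : NNReal) (j : Fin n) :
    MemLp (fun w : Fin n → ℝ => w j) 2 (gaussVec n v) := by
  have hid : MemLp (fun x : ℝ => x) 2 (gaussianReal 0 v) := memLp_id_gaussianReal' 2 (by simp)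
  exact hid.comp_measurePreserving (measurePreserving_eval (fun _ : Fin n => gaussianReal 0 v) j)

lemma gv_norm_memLp (n : ℕ) (v : NNReal) :
    MemLp (fun w : Fin n → ℝ => ‖w‖) 2 (gaussVec n v) := by
  have : MemLp (fun w : Fin n → ℝ => ∑ j, ‖w j‖) 2 (gaussVec n v) :=
    memLp_finsetSum _ fun j _ => (gv_coord_memLp n v j).norm
  refine this.mono' continuous_norm.aestronglyMeasurable (ae_of_all _ fun w => ?_)
  rw [norm_norm]
  refine (pi_norm_le_iff_of_nonneg (by positivity)).2 fun i => ?_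
  exact Finset.single_le_sum (f := fun j => ‖w j‖) (fun _ _ => norm_nonneg _) (Finset.mem_univ i)

lemma gv_coord_mean (n : ℕ) (v : NNReal) (j : Fin n) : ∫ w, w j ∂(gaussVec n v) = 0 := by
  have := (measurePreserving_eval (fun _ : Fin n => gaussianReal 0 v) j)
  have h2 := integral_map (μ := gaussVec n v) (φ := Function.eval j) (f := fun x : ℝ => x)
    (measurable_pi_apply j).aemeasurable (by fun_prop)
  rw [gaussVec, this.map_eq, integral_id_gaussianReal] at h2
  exact h2.symm

lemma gv_fderiv_int (n : ℕ) (v : NNReal) {K : NNReal} {f : (Fin n → ℝ) → ℝ}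
    (hf : LipschitzWith K f) (u : Fin n → ℝ) :
    Integrable (fun w => fderiv ℝ f w u) (gaussVec n v) :=
  Integrable.of_bound (measurable_fderiv_apply_const ℝ f u).aestronglyMeasurable (K * ‖u‖)
    (ae_of_all _ fun _ => (ContinuousLinearMap.le_opNorm _ _).trans
      (mul_le_mul_of_nonneg_right (norm_fderiv_le_of_lipschitz ℝ hf) (norm_nonneg _)))

lemma gv_stein (n : ℕ) (v : NNReal) (hv : v ≠ 0) {K : NNReal} {f : (Fin n → ℝ) → ℝ}
    (hf : LipschitzWith K f) (j : Fin n) :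
    ∫ w, w j * f w ∂(gaussVec n v) = v * ∫ w, fderiv ℝ f w (Pi.single j 1) ∂(gaussVec n v) := by
  obtain _ | n := n
  · exact j.elim0
  have m1 := (measurePreserving_piFinSuccAbove (fun _ : Fin (n+1) => gaussianReal 0 v) j).symm
  set e := (MeasurableEquiv.piFinSuccAbove (fun _ : Fin (n+1) => ℝ) j).symm with he
  have m1 : MeasurePreserving e ((gaussianReal 0 v).prod (gaussVec n v)) (gaussVec (n+1) v) := m1
  have hej (x : ℝ) (z : Fin n → ℝ) : e (x, z) j = x := by
    change Fin.insertNth (α := fun _ => ℝ) j x z j = x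
    simp
  have hadd (x y : ℝ) (z : Fin n → ℝ) : e (y, z) = e (x, z) + (y - x) • Pi.single j 1 := by
    change Fin.insertNth (α := fun _ => ℝ) j y z = Fin.insertNth (α := fun _ => ℝ) j x z + _
    ext i
    refine Fin.succAboveCases j ?_ (fun k => ?_) i <;> simp
  have hI1 : Integrable (fun w => w j * f w) (gaussVec (n+1) v) :=
    (gv_coord_memLp _ v j).integrable_mul (gv_lip_memLp _ (gv_norm_memLp _ v) hf)
  have hI2 := gv_fderiv_int (n+1) v hf (Pi.single j 1)
  have hdiff : ∀ᵐ w ∂(gaussVec (n+1) v), DifferentiableAt ℝ f w :=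
    (gv_ac _ v hv).ae_le hf.ae_differentiableAt
  have hdiff' := m1.quasiMeasurePreserving.ae hdiff
  have hD : ∀ᵐ p ∂((gaussianReal 0 v).prod (gaussVec n v)),
      fderiv ℝ f (e p) (Pi.single j 1) = deriv (fun y => f (e (y, p.2))) p.1 := by
    filter_upwards [hdiff'] with p hp
    have hl : HasDerivAt (fun y : ℝ => e (y, p.2)) (Pi.single j 1) p.1 := by
      have : (fun y : ℝ => e (y, p.2)) = fun y => e (p.1, p.2) + (y - p.1) • Pi.single j 1 := by
        ext1 y; exact hadd _ _ _
      rw [this]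
      simpa using ((((hasDerivAt_id p.1).sub_const p.1).smul_const
        (Pi.single j 1 : Fin (n+1) → ℝ)).const_add (e (p.1, p.2)))
    exact (hp.hasFDerivAt.comp_hasDerivAt p.1 hl).deriv.symm
  have hI1' : Integrable (fun p => e p j * f (e p)) ((gaussianReal 0 v).prod (gaussVec n v)) :=
    m1.integrable_comp_of_integrable hI1
  have hI2' := (m1.integrable_comp_of_integrable hI2).congr hD
  rw [← m1.integral_comp', ← m1.integral_comp', integral_congr_ae hD, integral_prod_symm _ hI1',
    integral_prod_symm _ hI2', ← integral_const_mul]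
  congr 1
  ext1 z
  simp only [hej]
  have hlz : LipschitzWith K (fun y => f (e (y, z))) := by
    refine LipschitzWith.of_dist_le_mul fun x y => ?_
    refine (hf.dist_le_mul _ _).trans (le_of_eq ?_)
    rw [hadd y x z, dist_eq_norm, add_sub_cancel_left, norm_smul, Pi.norm_single]
    simp [Real.dist_eq]
  exact gv_stein_one v hv hlz

lemma gv_lip_coord {Q : ℕ} {K : NNReal} {g : (Fin Q → ℝ) → (Fin Q → ℝ)} (hg : LipschitzWith K g)
    (k : Fin Q) : LipschitzWith K (fun w => g w k) :=
  LipschitzWith.of_dist_le_mul fun x y => (dist_le_pi_dist _ _ k).trans (hg.dist_le_mul x y)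

lemma gv_mulVec_memLp {M Q : ℕ} (v : NNReal) (A : Matrix (Fin M) (Fin Q) ℝ) {K : NNReal}
    {g : (Fin Q → ℝ) → (Fin Q → ℝ)} (hg : LipschitzWith K g) (i : Fin M) :
    MemLp (fun w => A.mulVec (g w) i) 2 (gaussVec Q v) := by
  simp only [Matrix.mulVec, dotProduct]
  refine memLp_finsetSum _ fun k _ => ?_
  exact (gv_lip_memLp _ (gv_norm_memLp Q v) (gv_lip_coord hg k)).const_mul (A i k)

lemma gv_trace {M Q : ℕ} (A : Matrix (Fin M) (Fin Q) ℝ) (J : Matrix (Fin Q) (Fin Q) ℝ) :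
    (A * J * Aᵀ).trace = ∑ i, ∑ j, ∑ k, A i j * A i k * J k j := by
  simp only [Matrix.trace, Matrix.diag_apply, Matrix.mul_apply, Matrix.transpose_apply,
    Finset.sum_mul]
  refine Finset.sum_congr rfl fun i _ => Finset.sum_congr rfl fun j _ =>
    Finset.sum_congr rfl fun k _ => by ring

lemma gv_trace_ae {M Q : ℕ} (v : NNReal) (hv : v ≠ 0) (A : Matrix (Fin M) (Fin Q) ℝ) {K : NNReal}
    {g : (Fin Q → ℝ) → (Fin Q → ℝ)} (hg : LipschitzWith K g) :
    (fun w => ∑ i, ∑ j, ∑ k, A i j * A i k * fderiv ℝ (fun w => g w k) w (Pi.single j 1))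
      =ᵐ[gaussVec Q v] fun w => (A * jacM g w * Aᵀ).trace := by
  have hdiff : ∀ᵐ w ∂(gaussVec Q v), DifferentiableAt ℝ g w :=
    (gv_ac _ v hv).ae_le hg.ae_differentiableAt
  filter_upwards [hdiff] with w hw
  rw [gv_trace]
  refine Finset.sum_congr rfl fun i _ => Finset.sum_congr rfl fun j _ =>
    Finset.sum_congr rfl fun k _ => ?_
  rw [jacM, LinearMap.toMatrix'_apply, fderiv_apply hw k]
  simp

lemma gv_trace_int {M Q : ℕ} (v : NNReal) (hv : v ≠ 0) (A : Matrix (Fin M) (Fin Q) ℝ) {K : NNReal}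
    {g : (Fin Q → ℝ) → (Fin Q → ℝ)} (hg : LipschitzWith K g) :
    Integrable (fun w => (A * jacM g w * Aᵀ).trace) (gaussVec Q v) := by
  refine Integrable.congr ?_ (gv_trace_ae v hv A hg)
  refine integrable_finsetSum _ fun i _ => integrable_finsetSum _ fun j _ =>
    integrable_finsetSum _ fun k _ => ?_
  exact (gv_fderiv_int Q v (gv_lip_coord hg k) _).const_mul _

lemma gv_key {M Q : ℕ} (v : NNReal) (hv : v ≠ 0) (A : Matrix (Fin M) (Fin Q) ℝ) {K : NNReal}
    {g : (Fin Q → ℝ) → (Fin Q → ℝ)} (hg : LipschitzWith K g) :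
    ∑ i, ∫ w, A.mulVec w i * A.mulVec (g w) i ∂(gaussVec Q v)
      = v * ∫ w, (A * jacM g w * Aᵀ).trace ∂(gaussVec Q v) := by
  have hI (i : Fin M) (j k : Fin Q) : Integrable (fun w =>
      A i j * A i k * fderiv ℝ (fun w => g w k) w (Pi.single j 1)) (gaussVec Q v) :=
    (gv_fderiv_int Q v (gv_lip_coord hg k) _).const_mul _
  have hI2 (i : Fin M) (j k : Fin Q) : Integrable (fun w : Fin Q → ℝ =>
      A i j * A i k * (w j * g w k)) (gaussVec Q v) :=
    ((gv_coord_memLp Q v j).integrable_mul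
      (gv_lip_memLp _ (gv_norm_memLp Q v) (gv_lip_coord hg k))).const_mul _
  rw [← integral_congr_ae (gv_trace_ae v hv A hg),
    integral_finsetSum _ fun i _ => integrable_finsetSum _ fun j _ =>
      integrable_finsetSum _ fun k _ => hI i j k, Finset.mul_sum]
  refine Finset.sum_congr rfl fun i _ => ?_
  rw [integral_finsetSum _ fun j _ => integrable_finsetSum _ fun k _ => hI i j k, Finset.mul_sum]
  have e (w : Fin Q → ℝ) : A.mulVec w i * A.mulVec (g w) i
      = ∑ j, ∑ k, A i j * A i k * (w j * g w k) := by
    simp only [Matrix.mulVec, dotProduct, Finset.sum_mul_sum]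
    refine Finset.sum_congr rfl fun j _ => Finset.sum_congr rfl fun k _ => by ring
  simp only [e]
  rw [integral_finsetSum _ fun j _ => integrable_finsetSum _ fun k _ => hI2 i j k]
  refine Finset.sum_congr rfl fun j _ => ?_
  rw [integral_finsetSum _ fun k _ => hI2 i j k, integral_finsetSum _ fun k _ => hI i j k,
    Finset.mul_sum]
  refine Finset.sum_congr rfl fun k _ => ?_
  rw [integral_const_mul, integral_const_mul, gv_stein Q v hv (gv_lip_coord hg k) j]
  ring

lemma gv_mulVec_mean {M Q : ℕ} (v : NNReal) (A : Matrix (Fin M) (Fin Q) ℝ) (i : Fin M) :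
    ∫ w, A.mulVec w i ∂(gaussVec Q v) = 0 := by
  simp only [Matrix.mulVec, dotProduct]
  rw [integral_finsetSum _ fun j _ =>
    ((gv_coord_memLp Q v j).integrable (by norm_num)).const_mul _]
  refine Finset.sum_eq_zero fun j _ => ?_
  rw [integral_const_mul, gv_coord_mean, mul_zero]

lemma gv_sq {M Q : ℕ} (v : NNReal) (hv : v ≠ 0) (A : Matrix (Fin M) (Fin Q) ℝ) :
    ∑ i, ∫ w, A.mulVec w i * A.mulVec w i ∂(gaussVec Q v) = v * (Aᵀ * A).trace := by
  have h := gv_key v hv A (LipschitzWith.id (α := Fin Q → ℝ))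
  simp only [id] at h
  rw [h]
  have : ∀ w : Fin Q → ℝ, jacM id w = 1 := fun w => by
    rw [jacM, fderiv_id]
    exact LinearMap.toMatrix'_id
  simp only [this, Matrix.mul_one]
  rw [Matrix.trace_mul_comm]
  simp

/-- Unbiasedness of the GSURE: `E_w[GSURE^A(y)] = E_w[‖Aμ₀ − Aμ̂(y)‖₂²]` and
`tr(A (∂μ̂(y)/∂y) A*)` is an unbiased estimator of `DOF^A = Σᵢ cov((Ay)ᵢ, (Aμ̂(y))ᵢ)/σ²`. -/
theorem gsure_unbiased
    {N Q M : ℕ} (hN : 0 < N) (hQ : 0 < Q) (hM : 0 < M)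
    (Φ : Matrix (Fin Q) (Fin N) ℝ) (x0 : Fin N → ℝ) (σ : ℝ) (hσ : 0 < σ)
    (xhat : (Fin Q → ℝ) → (Fin N → ℝ))
    (muHat : (Fin Q → ℝ) → (Fin Q → ℝ))
    (hmuHat : ∀ y, muHat y = Φ.mulVec (xhat y))
    (K : NNReal) (hlip : LipschitzWith K muHat)
    (A : Matrix (Fin M) (Fin Q) ℝ)
    (μ : Measure (Fin Q → ℝ)) (hμ : μ = gaussVec Q ⟨σ ^ 2, sq_nonneg σ⟩) :
    (∫ w, GSURE A σ muHat (Φ.mulVec x0 + w) ∂μ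
        = ∫ w, ∑ i, (A.mulVec (Φ.mulVec x0 - muHat (Φ.mulVec x0 + w)) i) ^ 2 ∂μ) ∧
    (∫ w, (A * jacM muHat (Φ.mulVec x0 + w) * Aᵀ).trace ∂μ
        = (∑ i,
            ∫ w, (A.mulVec (Φ.mulVec x0 + w) i
                    - ∫ w', A.mulVec (Φ.mulVec x0 + w') i ∂μ)
                * (A.mulVec (muHat (Φ.mulVec x0 + w)) i
                    - ∫ w', A.mulVec (muHat (Φ.mulVec x0 + w')) i ∂μ) ∂μ) / σ ^ 2) := by

  obtain ⟨v, hvdef⟩ : ∃ v : NNReal, v = ⟨σ ^ 2, sq_nonneg σ⟩ := ⟨_, rfl⟩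
  have hvσ : (v : ℝ) = σ ^ 2 := by rw [hvdef]; rfl
  have hv : v ≠ 0 := by
    intro h
    rw [h] at hvσ
    have : 0 < σ ^ 2 := by positivity
    rw [← hvσ] at this
    simp at this
  rw [← hvdef] at hμ
  subst hμ
  set m := Φ.mulVec x0 with hm
  set g : (Fin Q → ℝ) → (Fin Q → ℝ) := fun w => muHat (m + w) with hgdef
  have hg : LipschitzWith K g := by
    refine LipschitzWith.of_dist_le_mul fun x y => (hlip.dist_le_mul _ _).trans ?_
    rw [dist_add_left]
  have hjac : ∀ w, jacM muHat (m + w) = jacM g w := fun w => by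
    rw [jacM, jacM, hgdef, fderiv_comp_add_left]
  have hgw : ∀ w, muHat (m + w) = g w := fun w => rfl
  have hkey := gv_key v hv A hg
  have hsq := gv_sq v hv A
  have hT := gv_trace_int v hv A hg
  have hmean := gv_mulVec_mean v A
  rw [hvσ] at hkey hsq
  have hAw (i : Fin M) : MemLp (fun w => A.mulVec w i) 2 (gaussVec Q v) :=
    gv_mulVec_memLp v A (LipschitzWith.id (α := Fin Q → ℝ)) i
  have hAg (i : Fin M) : MemLp (fun w => A.mulVec (g w) i) 2 (gaussVec Q v) :=
    gv_mulVec_memLp v A hg i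
  have hAw1 (i : Fin M) : Integrable (fun w => A.mulVec w i) (gaussVec Q v) :=
    (hAw i).integrable (by norm_num)
  have hAwg (i : Fin M) : Integrable (fun w => A.mulVec w i * A.mulVec (g w) i) (gaussVec Q v) :=
    (hAw i).integrable_mul (hAg i)
  have hAww (i : Fin M) : Integrable (fun w => A.mulVec w i * A.mulVec w i) (gaussVec Q v) :=
    (hAw i).integrable_mul (hAw i)
  have hB (i : Fin M) : Integrable (fun w => (A.mulVec (m - g w) i) ^ 2) (gaussVec Q v) := by
    have : MemLp (fun w => A.mulVec (m - g w) i) 2 (gaussVec Q v) := by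
      simp only [Matrix.mulVec_sub, Pi.sub_apply]
      exact (memLp_const (A.mulVec m i)).sub (hAg i)
    exact this.integrable_sq
  constructor
  · have e (w : Fin Q → ℝ) : GSURE A σ muHat (m + w)
        = (∑ i, (A.mulVec (m - g w) i) ^ 2)
          + ((∑ i, 2 * (A.mulVec m i * A.mulVec w i)) - (∑ i, 2 * (A.mulVec w i * A.mulVec (g w) i))
          + ((∑ i, A.mulVec w i * A.mulVec w i) - σ ^ 2 * (Aᵀ * A).trace
          + 2 * σ ^ 2 * (A * jacM g w * Aᵀ).trace)) := by
      rw [GSURE, hjac, hgw]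
      have : ∑ i, (A.mulVec (m + w - g w) i) ^ 2 = (∑ i, (A.mulVec (m - g w) i) ^ 2)
          + ((∑ i, 2 * (A.mulVec m i * A.mulVec w i)) - (∑ i, 2 * (A.mulVec w i * A.mulVec (g w) i))
          + (∑ i, A.mulVec w i * A.mulVec w i)) := by
        rw [← Finset.sum_sub_distrib, ← Finset.sum_add_distrib, ← Finset.sum_add_distrib]
        refine Finset.sum_congr rfl fun i _ => ?_
        simp only [Matrix.mulVec_sub, Matrix.mulVec_add, Pi.sub_apply, Pi.add_apply]
        ring
      rw [this]; ring
    simp only [e]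
    have i1 : Integrable (fun w => ∑ i, (A.mulVec (m - g w) i) ^ 2) (gaussVec Q v) :=
      integrable_finsetSum _ fun i _ => hB i
    have i2 : Integrable (fun w => ∑ i, 2 * (A.mulVec m i * A.mulVec w i)) (gaussVec Q v) :=
      integrable_finsetSum _ fun i _ => ((hAw1 i).const_mul _).const_mul _
    have i3 : Integrable (fun w => ∑ i, 2 * (A.mulVec w i * A.mulVec (g w) i)) (gaussVec Q v) :=
      integrable_finsetSum _ fun i _ => (hAwg i).const_mul _
    have i4 : Integrable (fun w => ∑ i, A.mulVec w i * A.mulVec w i) (gaussVec Q v) :=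
      integrable_finsetSum _ fun i _ => hAww i
    have i5 : Integrable (fun w => 2 * σ ^ 2 * (A * jacM g w * Aᵀ).trace) (gaussVec Q v) :=
      hT.const_mul _
    have i6 : Integrable (fun _ : Fin Q → ℝ => σ ^ 2 * (Aᵀ * A).trace) (gaussVec Q v) :=
      integrable_const _
    have j23 := integral_sub i2 i3
    have j46 := integral_sub i4 i6
    have j465 := integral_add (i4.sub i6) i5
    have j := integral_add (i2.sub i3) ((i4.sub i6).add i5)
    have jj := integral_add i1 ((i2.sub i3).add ((i4.sub i6).add i5))
    simp only [Pi.sub_apply, Pi.add_apply] at j23 j46 j465 j jj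
    rw [jj, j, j23, j465, j46]
    have v2 : ∫ w, ∑ i, 2 * (A.mulVec m i * A.mulVec w i) ∂(gaussVec Q v) = 0 := by
      rw [integral_finsetSum _ fun i _ => ((hAw1 i).const_mul _).const_mul _]
      refine Finset.sum_eq_zero fun i _ => ?_
      rw [integral_const_mul, integral_const_mul, hmean, mul_zero, mul_zero]
    have v3 : ∫ w, ∑ i, 2 * (A.mulVec w i * A.mulVec (g w) i) ∂(gaussVec Q v)
        = 2 * (σ ^ 2 * ∫ w, (A * jacM g w * Aᵀ).trace ∂(gaussVec Q v)) := by
      rw [integral_finsetSum _ fun i _ => (hAwg i).const_mul _, ← hkey, Finset.mul_sum]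
      refine Finset.sum_congr rfl fun i _ => ?_
      rw [integral_const_mul]
    have v4 : ∫ w, ∑ i, A.mulVec w i * A.mulVec w i ∂(gaussVec Q v)
        = σ ^ 2 * (Aᵀ * A).trace := by
      rw [integral_finsetSum _ fun i _ => hAww i, hsq]
    have v5 : ∫ w, 2 * σ ^ 2 * (A * jacM g w * Aᵀ).trace ∂(gaussVec Q v)
        = 2 * σ ^ 2 * ∫ w, (A * jacM g w * Aᵀ).trace ∂(gaussVec Q v) := integral_const_mul _ _
    rw [v2, v3, v4, v5, integral_const]
    simp only [probReal_univ, one_smul]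
    ring
  · have hσ2 : σ ^ 2 ≠ 0 := by positivity
    rw [eq_div_iff hσ2, mul_comm]
    simp only [hjac]
    rw [← hkey]
    refine Finset.sum_congr rfl fun i _ => ?_
    have hc : ∫ w', A.mulVec (m + w') i ∂(gaussVec Q v) = A.mulVec m i := by
      simp only [Matrix.mulVec_add, Pi.add_apply]
      rw [integral_add (integrable_const _) (hAw1 i), hmean, integral_const]
      simp
    rw [hc]
    generalize ∫ w', A.mulVec (muHat (m + w')) i ∂(gaussVec Q v) = c
    have e (w : Fin Q → ℝ) : (A.mulVec (m + w) i - A.mulVec m i) * (A.mulVec (muHat (m + w)) i - c)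
        = A.mulVec w i * A.mulVec (g w) i - c * A.mulVec w i := by
      rw [hgw]
      simp only [Matrix.mulVec_add, Pi.add_apply]
      ring
    simp only [e]
    rw [integral_sub (hAwg i) ((hAw1 i).const_mul c), integral_const_mul, hmean]
    simp
end

section
/- Let A ∈ ℝ^{M×Q} and write J(y) = ∂μ̂(y)/∂y for the Jacobian of the prediction. Then E_w[(GSURE^A(y) − SE^A(y))²] = 2σ⁴ tr[(A* A)²] + 4σ² E_w[‖A* A (μ₀ − μ̂(y))‖₂²] − 4σ⁴ E_w[tr( A J(y) A* A (2 Id − J(y)) A* )]. -/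
open Matrix MeasureTheory ProbabilityTheory

namespace GS

noncomputable def dens (Q : ℕ) (v : NNReal) (w : Fin Q → ℝ) : ℝ := ∏ i, gaussianPDFReal 0 v (w i)

instance (Q : ℕ) (v : NNReal) : IsProbabilityMeasure (gaussVec Q v) := by
  unfold gaussVec; infer_instance

lemma dens_nonneg (Q : ℕ) (v : NNReal) (w : Fin Q → ℝ) : 0 ≤ dens Q v w :=
  Finset.prod_nonneg fun _ _ => gaussianPDFReal_nonneg _ _ _

lemma dens_integrable (Q : ℕ) (v : NNReal) : Integrable (dens Q v) := by
  unfold dens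
  exact Integrable.fintype_prod (f := fun _ : Fin Q => gaussianPDFReal 0 v)
    (fun _ => integrable_gaussianPDFReal 0 v)

lemma gaussVec_eq (Q : ℕ) (v : NNReal) (hv : v ≠ 0) :
    gaussVec Q v = volume.withDensity (fun w => ENNReal.ofReal (dens Q v w)) := by
  unfold gaussVec
  refine (Measure.pi_eq fun s hs => ?_)
  rw [withDensity_apply _ (MeasurableSet.univ_pi hs),
    ← ofReal_integral_eq_lintegral_ofReal (dens_integrable Q v).integrableOn
      (Filter.Eventually.of_forall (dens_nonneg Q v))]
  simp_rw [gaussianReal_apply_eq_integral 0 hv]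
  rw [← ENNReal.ofReal_prod_of_nonneg
    (fun i _ => integral_nonneg fun x => gaussianPDFReal_nonneg _ _ _)]
  congr 1
  rw [volume_pi, Measure.restrict_pi_pi]
  unfold dens
  exact integral_fintype_prod_eq_prod (fun _ => gaussianPDFReal 0 v)

lemma gaussVec_ac (Q : ℕ) (v : NNReal) (hv : v ≠ 0) : gaussVec Q v ≪ volume := by
  rw [gaussVec_eq Q v hv]; exact withDensity_absolutelyContinuous _ _

lemma dens_meas (Q : ℕ) (v : NNReal) : Measurable (dens Q v) := by
  unfold dens
  exact Finset.measurable_prod _ fun i _ => (measurable_gaussianPDFReal 0 v).comp (measurable_pi_apply i)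

lemma integral_gaussVec (Q : ℕ) (v : NNReal) (hv : v ≠ 0) (F : (Fin Q → ℝ) → ℝ) :
    ∫ w, F w ∂(gaussVec Q v) = ∫ w, dens Q v w * F w := by
  rw [gaussVec_eq Q v hv, integral_withDensity_eq_integral_toReal_smul
    (dens_meas Q v).ennreal_ofReal (by simp)]
  simp [ENNReal.toReal_ofReal (dens_nonneg Q v _)]

lemma integrable_gaussVec (Q : ℕ) (v : NNReal) (hv : v ≠ 0) (F : (Fin Q → ℝ) → ℝ) :
    Integrable F (gaussVec Q v) ↔ Integrable (fun w => dens Q v w * F w) := by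
  rw [gaussVec_eq Q v hv, integrable_withDensity_iff_integrable_smul'
    (dens_meas Q v).ennreal_ofReal (by simp)]
  simp [ENNReal.toReal_ofReal (dens_nonneg Q v _)]

lemma dens_eq (Q : ℕ) (v : NNReal) (w : Fin Q → ℝ) :
    dens Q v w = (√(2 * Real.pi * v))⁻¹ ^ Q * Real.exp (- (∑ i, w i ^ 2) / (2 * v)) := by
  unfold dens gaussianPDFReal
  rw [Finset.prod_mul_distrib, ← Real.exp_sum]
  simp [Finset.sum_div, neg_div, Finset.sum_neg_distrib]

lemma dens_contDiff (Q : ℕ) (v : NNReal) : ContDiff ℝ ⊤ (dens Q v) := by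
  rw [funext (dens_eq Q v)]
  fun_prop

lemma dens_fderiv (Q : ℕ) (v : NNReal) (w : Fin Q → ℝ) (i : Fin Q) :
    fderiv ℝ (dens Q v) w (Pi.single i 1) = - (w i / v) * dens Q v w := by
  have h : HasFDerivAt (fun w : Fin Q → ℝ => - (∑ i, w i ^ 2) / (2 * v))
      ((2 * (v:ℝ))⁻¹ • (-(∑ i, (2 * w i) • (ContinuousLinearMap.proj i : (Fin Q → ℝ) →L[ℝ] ℝ)))) w := by
    simp_rw [div_eq_inv_mul]
    refine HasFDerivAt.const_mul (HasFDerivAt.neg (HasFDerivAt.fun_sum fun i _ => ?_)) _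
    have := (hasFDerivAt_apply (𝕜 := ℝ) (F' := fun _ : Fin Q => ℝ) i w).pow 2
    simpa using this
  have h2 := (h.exp).const_mul ((√(2 * Real.pi * v))⁻¹ ^ Q)
  rw [funext (dens_eq Q v), h2.fderiv]
  simp [Pi.single_apply]
  field_simp

/-- polynomial moments -/
lemma integrable_pow (Q : ℕ) (v : NNReal) (k : ℕ) :
    Integrable (fun w : Fin Q → ℝ => (1 + ‖w‖) ^ k) (gaussVec Q v) := by
  have h0 : ∀ i : Fin Q, MemLp (fun w : Fin Q → ℝ => w i) (k : ENNReal) (gaussVec Q v) := by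
    intro i
    have hm : MeasurePreserving (Function.eval i) (gaussVec Q v) (gaussianReal 0 v) :=
      measurePreserving_eval (fun _ : Fin Q => gaussianReal 0 v) i
    have h1 : MemLp id (k : ENNReal) (gaussianReal 0 v) := memLp_id_gaussianReal' _ (by simp)
    exact h1.comp_measurePreserving hm
  have h : MemLp (fun w : Fin Q → ℝ => w) (k : ENNReal) (gaussVec Q v) := MemLp.of_eval h0
  have h3 : MemLp (fun _ : Fin Q → ℝ => (1:ℝ)) (k : ENNReal) (gaussVec Q v) := memLp_const 1
  have h2 : MemLp (fun w : Fin Q → ℝ => 1 + ‖w‖) (k : ENNReal) (gaussVec Q v) := h3.add h.norm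
  have h4 := h2.integrable_norm_pow'
  refine h4.congr (Filter.Eventually.of_forall fun w => ?_)
  have : 0 ≤ 1 + ‖w‖ := by positivity
  simp only [Real.norm_of_nonneg this]


open Filter Topology

variable {Q : ℕ} {v : NNReal}

/-- Sequences of functions with uniform polynomial growth converging almost everywhere. -/
structure Good (Q : ℕ) (v : NNReal) (a : ℕ → (Fin Q → ℝ) → ℝ) (b : (Fin Q → ℝ) → ℝ) : Prop where
  meas : ∀ n, AEStronglyMeasurable (a n) (gaussVec Q v)
  bd : ∃ (C : ℝ) (k : ℕ), 0 ≤ C ∧ ∀ n w, |a n w| ≤ C * (1 + ‖w‖) ^ k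
  lim : ∀ᵐ w ∂(gaussVec Q v), Tendsto (fun n => a n w) atTop (𝓝 (b w))

namespace Good

variable {a a' : ℕ → (Fin Q → ℝ) → ℝ} {b b' : (Fin Q → ℝ) → ℝ}

lemma mul (h : Good Q v a b) (h' : Good Q v a' b') :
    Good Q v (fun n w => a n w * a' n w) (fun w => b w * b' w) := by
  refine ⟨fun n => (h.meas n).mul (h'.meas n), ?_, ?_⟩
  · obtain ⟨C, k, hC, hb⟩ := h.bd
    obtain ⟨C', k', hC', hb'⟩ := h'.bd
    refine ⟨C * C', k + k', by positivity, fun n w => ?_⟩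
    rw [abs_mul, pow_add]
    calc |a n w| * |a' n w| ≤ (C * (1 + ‖w‖) ^ k) * (C' * (1 + ‖w‖) ^ k') := by
          gcongr
          · exact hb n w
          · exact hb' n w
      _ = _ := by ring
  · filter_upwards [h.lim, h'.lim] with w h1 h2 using h1.mul h2

lemma add (h : Good Q v a b) (h' : Good Q v a' b') :
    Good Q v (fun n w => a n w + a' n w) (fun w => b w + b' w) := by
  refine ⟨fun n => (h.meas n).add (h'.meas n), ?_, ?_⟩
  · obtain ⟨C, k, hC, hb⟩ := h.bd
    obtain ⟨C', k', hC', hb'⟩ := h'.bd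
    refine ⟨C + C', k + k', by positivity, fun n w => ?_⟩
    have h1 : 1 ≤ 1 + ‖w‖ := by linarith [norm_nonneg w]
    calc |a n w + a' n w| ≤ |a n w| + |a' n w| := abs_add_le _ _
      _ ≤ C * (1 + ‖w‖) ^ k + C' * (1 + ‖w‖) ^ k' := add_le_add (hb n w) (hb' n w)
      _ ≤ C * (1 + ‖w‖) ^ (k + k') + C' * (1 + ‖w‖) ^ (k + k') := by
          gcongr <;> omega
      _ = _ := by ring
  · filter_upwards [h.lim, h'.lim] with w h1 h2 using h1.add h2

lemma const (c : ℝ) : Good Q v (fun _ _ => c) (fun _ => c) :=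
  ⟨fun _ => aestronglyMeasurable_const, ⟨|c|, 0, abs_nonneg _, fun _ _ => by simp⟩,
    Eventually.of_forall fun _ => tendsto_const_nhds⟩

lemma coord (i : Fin Q) : Good Q v (fun _ w => w i) (fun w => w i) :=
  ⟨fun _ => (measurable_pi_apply i).aestronglyMeasurable, ⟨1, 1, by norm_num, fun _ w => by
    have := norm_le_pi_norm w i
    rw [Real.norm_eq_abs] at this
    linarith⟩,
    Eventually.of_forall fun _ => tendsto_const_nhds⟩

lemma sub (h : Good Q v a b) (h' : Good Q v a' b') :
    Good Q v (fun n w => a n w - a' n w) (fun w => b w - b' w) := by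
  have := h.add ((const (-1)).mul h')
  simpa [sub_eq_add_neg] using this

lemma sq (h : Good Q v a b) : Good Q v (fun n w => a n w ^ 2) (fun w => b w ^ 2) := by
  simpa [pow_two] using h.mul h

lemma sum {ι : Type*} (s : Finset ι) {a : ι → ℕ → (Fin Q → ℝ) → ℝ} {b : ι → (Fin Q → ℝ) → ℝ}
    (h : ∀ i, Good Q v (a i) (b i)) :
    Good Q v (fun n w => ∑ i ∈ s, a i n w) (fun w => ∑ i ∈ s, b i w) := by
  classical
  induction s using Finset.induction_on with
  | empty => simpa using const 0
  | insert i s hi ih =>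
    simp only [Finset.sum_insert hi]
    exact (h i).add ih

lemma integrable (h : Good Q v a b) (n : ℕ) : Integrable (a n) (gaussVec Q v) := by
  obtain ⟨C, k, hC, hb⟩ := h.bd
  exact ((integrable_pow Q v k).const_mul C).mono' (h.meas n) (Eventually.of_forall (hb n))

lemma tendsto (h : Good Q v a b) :
    Tendsto (fun n => ∫ w, a n w ∂(gaussVec Q v)) atTop (𝓝 (∫ w, b w ∂(gaussVec Q v))) := by
  obtain ⟨C, k, hC, hb⟩ := h.bd
  exact tendsto_integral_of_dominated_convergence _ h.meas
    ((integrable_pow Q v k).const_mul C) (fun n => Eventually.of_forall (hb n)) h.lim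

end Good

/-- functions of polynomial growth -/
abbrev PG (Q : ℕ) (v : NNReal) (f : (Fin Q → ℝ) → ℝ) : Prop := Good Q v (fun _ => f) f

/-- partial derivative -/
noncomputable def pd (i : Fin Q) (f : (Fin Q → ℝ) → ℝ) (w : Fin Q → ℝ) : ℝ :=
  fderiv ℝ f w (Pi.single i 1)

lemma ibp (hv : v ≠ 0) (F : (Fin Q → ℝ) → ℝ) (i : Fin Q) (hF : Differentiable ℝ F)
    (h : PG Q v F) (h' : PG Q v (pd i F)) :
    ∫ w, (w i * F w - v * pd i F w) ∂(gaussVec Q v) = 0 := by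
  have hv' : (v : ℝ) ≠ 0 := by exact_mod_cast hv
  have i1 : Integrable (fun w => w i * F w) (gaussVec Q v) := ((Good.coord i).mul h).integrable 0
  have i2 : Integrable (fun w => pd i F w) (gaussVec Q v) := h'.integrable 0
  have i3 : Integrable (fun w => F w) (gaussVec Q v) := h.integrable 0
  rw [integral_sub i1 (i2.const_mul _), integral_const_mul, integral_gaussVec Q v hv,
    integral_gaussVec Q v hv]
  rw [integrable_gaussVec Q v hv] at i1 i2 i3
  have key := integral_mul_fderiv_eq_neg_fderiv_mul_of_integrable (μ := volume)
    (f := dens Q v) (g := F) (v := Pi.single i 1)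
    (by
      refine (i1.const_mul (-(v:ℝ)⁻¹)).congr (Eventually.of_forall fun w => ?_)
      simp only [dens_fderiv]; field_simp)
    i2 i3 (fun x _ => ((dens_contDiff Q v).differentiable (by simp)) x) (fun x _ => hF x)
  simp only [pd]
  rw [key, ← integral_neg, ← integral_const_mul, sub_eq_zero]
  congr 1; ext w
  rw [dens_fderiv]; field_simp

lemma pd_mul {f g : (Fin Q → ℝ) → ℝ} (hf : Differentiable ℝ f) (hg : Differentiable ℝ g)
    (i : Fin Q) (w) : pd i (fun w => f w * g w) w = f w * pd i g w + pd i f w * g w := by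
  unfold pd
  rw [fderiv_fun_mul (hf w) (hg w)]
  simp; ring

lemma pd_sub {f g : (Fin Q → ℝ) → ℝ} (hf : Differentiable ℝ f) (hg : Differentiable ℝ g)
    (i : Fin Q) (w) : pd i (fun w => f w - g w) w = pd i f w - pd i g w := by
  unfold pd
  rw [fderiv_fun_sub (hf w) (hg w)]
  simp

lemma pd_const_mul {f : (Fin Q → ℝ) → ℝ} (hf : Differentiable ℝ f) (c : ℝ)
    (i : Fin Q) (w) : pd i (fun w => c * f w) w = c * pd i f w := by
  unfold pd
  rw [fderiv_const_mul (hf w)]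
  simp

lemma pd_coord (i j : Fin Q) (w) : pd i (fun w => w j) w = if i = j then 1 else 0 := by
  unfold pd
  rw [(hasFDerivAt_apply (𝕜 := ℝ) (F' := fun _ : Fin Q => ℝ) j w).fderiv]
  simp [Pi.single_apply, eq_comm]

lemma pd_contDiff {f : (Fin Q → ℝ) → ℝ} (hf : ContDiff ℝ 2 f) (i : Fin Q) :
    ContDiff ℝ 1 (pd i f) := by
  unfold pd
  exact (hf.fderiv_right (m := 1) (by norm_num)).clm_apply contDiff_const

lemma pd_comm {f : (Fin Q → ℝ) → ℝ} (hf : ContDiff ℝ 2 f) (i j : Fin Q) (w) :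
    pd i (pd j f) w = pd j (pd i f) w := by
  have hs : IsSymmSndFDerivAt ℝ f w := hf.contDiffAt.isSymmSndFDerivAt (by simp)
  have hd : DifferentiableAt ℝ (fderiv ℝ f) w :=
    (hf.fderiv_right (m := 1) (by norm_num)).differentiable (by norm_num) w
  have : ∀ i j : Fin Q, pd i (pd j f) w
      = fderiv ℝ (fderiv ℝ f) w (Pi.single i 1) (Pi.single j 1) := by
    intro i j
    unfold pd
    rw [fderiv_clm_apply hd (differentiableAt_const _)]
    simp
  rw [this, this]
  exact hs _ _

lemma second (hv : v ≠ 0) {f h : (Fin Q → ℝ) → ℝ} (hf : ContDiff ℝ 2 f) (hh : ContDiff ℝ 2 h)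
    (gf : PG Q v f) (gf' : ∀ i, PG Q v (pd i f))
    (gh : PG Q v h) (gh' : ∀ i, PG Q v (pd i h)) (gh'' : ∀ i j, PG Q v (pd i (pd j h)))
    (i j : Fin Q) :
    ∫ w, ((w i * f w - v * pd i f w) * (w j * h w - v * pd j h w)
      - (v * (if i = j then 1 else 0) * (f w * h w) + v ^ 2 * (pd j f w * pd i h w)))
        ∂(gaussVec Q v) = 0 := by
  have df : Differentiable ℝ f := hf.differentiable (by norm_num)
  have dh : Differentiable ℝ h := hh.differentiable (by norm_num)
  have dph : ∀ i, Differentiable ℝ (pd i h) := fun i =>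
    (pd_contDiff hh i).differentiable (by norm_num)
  have dc : Differentiable ℝ (fun w : Fin Q → ℝ => w j) := by fun_prop
  have d1 : Differentiable ℝ (fun w => w j * h w) := dc.mul dh
  have d2 : Differentiable ℝ (fun w => (v:ℝ) * pd j h w) := (dph j).const_mul _
  have dG : Differentiable ℝ (fun w => w j * h w - v * pd j h w) := d1.sub d2
  have pG : ∀ w, pd i (fun w => w j * h w - v * pd j h w) w
      = w j * pd i h w + (if i = j then 1 else 0) * h w - v * pd j (pd i h) w := by
    intro w
    rw [pd_sub d1 d2, pd_mul dc dh, pd_const_mul (dph j), pd_coord, pd_comm hh i j]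
  have gG : PG Q v (fun w => w j * h w - v * pd j h w) :=
    ((Good.coord j).mul gh).sub ((Good.const _).mul (gh' j))
  have gG' : PG Q v (pd i (fun w => w j * h w - v * pd j h w)) := by
    unfold PG
    rw [funext pG]
    exact (((Good.coord j).mul (gh' i)).add ((Good.const _).mul gh)).sub
      ((Good.const _).mul (gh'' j i))
  have p1 : ∀ w, pd i (fun w => f w * (w j * h w - v * pd j h w)) w = _ :=
    fun w => pd_mul df dG i w
  have p2 : ∀ w, pd j (fun w => f w * pd i h w) w = _ :=
    fun w => pd_mul df (dph i) j w
  have g1 : PG Q v (fun w => f w * (w j * h w - v * pd j h w)) := gf.mul gG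
  have g1' : PG Q v (pd i (fun w => f w * (w j * h w - v * pd j h w))) := by
    unfold PG; rw [funext p1]
    exact (gf.mul gG').add ((gf' i).mul gG)
  have g2 : PG Q v (fun w => f w * pd i h w) := gf.mul (gh' i)
  have g2' : PG Q v (pd j (fun w => f w * pd i h w)) := by
    unfold PG; rw [funext p2]
    exact (gf.mul (gh'' j i)).add ((gf' j).mul (gh' i))
  have k1 := ibp hv _ i (df.mul dG) g1 g1'
  have k2 := ibp hv _ j (df.mul (dph i)) g2 g2'
  have I1 := (((Good.coord i).mul g1).sub ((Good.const (v:ℝ)).mul g1')).integrable 0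
  have I2 := (((Good.coord j).mul g2).sub ((Good.const (v:ℝ)).mul g2')).integrable 0
  have := integral_add I1 (I2.const_mul (v:ℝ))
  rw [integral_const_mul] at this
  erw [k1, k2] at this
  rw [mul_zero, add_zero] at this
  refine Eq.trans ?_ this
  congr 1; ext w
  rw [p1, p2, pG]
  ring

open scoped Convolution

lemma convo_fderiv {K : NNReal} {u : (Fin Q → ℝ) → (Fin Q → ℝ)} (hu : LipschitzWith K u)
    (φ : ContDiffBump (0 : Fin Q → ℝ)) (x : Fin Q → ℝ) :
    HasFDerivAt (φ.normed volume ⋆[ContinuousLinearMap.lsmul ℝ ℝ, volume] u)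
      ((φ.normed volume ⋆[ContinuousLinearMap.lsmul ℝ ℝ, volume] (fderiv ℝ u)) x) x := by
  have hφi : Integrable (φ.normed (volume : Measure (Fin Q → ℝ))) := φ.integrable_normed
  have hφc : Continuous (φ.normed (volume : Measure (Fin Q → ℝ))) := φ.continuous_normed
  have hφs : HasCompactSupport (φ.normed (volume : Measure (Fin Q → ℝ))) :=
    φ.hasCompactSupport_normed
  have hc : ∀ x, Continuous (fun t => φ.normed volume t • u (x - t)) := fun x =>
    hφc.smul (hu.continuous.comp (by fun_prop))
  refine (hasFDerivAt_integral_of_dominated_loc_of_lip (s := Set.univ)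
    (bound := fun t => φ.normed volume t * K)
    (F := fun x t => φ.normed volume t • u (x - t))
    (F' := fun t => φ.normed volume t • fderiv ℝ u (x - t)) Filter.univ_mem
    (Eventually.of_forall fun y => (hc y).aestronglyMeasurable) ?_ ?_ ?_ ?_ ?_).2
  · exact (hc x).integrable_of_hasCompactSupport hφs.smul_right
  · refine hφc.aestronglyMeasurable.smul ?_
    exact ((measurable_fderiv ℝ u).comp (by fun_prop)).aestronglyMeasurable
  · refine Eventually.of_forall fun t => ?_
    rw [lipschitzOnWith_univ]
    refine LipschitzWith.of_dist_le_mul fun y z => ?_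
    rw [dist_eq_norm, ← smul_sub, norm_smul, ← dist_eq_norm]
    have := hu.dist_le_mul (y - t) (z - t)
    rw [dist_sub_right] at this
    have h0 := φ.nonneg_normed (μ := volume) t
    simp only [Real.coe_nnabs, abs_mul, NNReal.abs_eq, Real.norm_eq_abs]
    rw [mul_assoc]
    gcongr
  · exact hφi.mul_const _
  · have hae : ∀ᵐ t : Fin Q → ℝ, DifferentiableAt ℝ u (x - t) :=
      (Measure.measurePreserving_sub_left volume x).quasiMeasurePreserving.ae hu.ae_differentiableAt
    filter_upwards [hae] with t ht
    refine HasFDerivAt.fun_const_smul ?_ _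
    have := ht.hasFDerivAt.comp x ((hasFDerivAt_id x).sub_const t)
    simpa using this

lemma convo_lip {K : NNReal} {u : (Fin Q → ℝ) → (Fin Q → ℝ)} (hu : LipschitzWith K u)
    (φ : ContDiffBump (0 : Fin Q → ℝ)) :
    LipschitzWith K (φ.normed volume ⋆[ContinuousLinearMap.lsmul ℝ ℝ, volume] u) := by
  have hφi : Integrable (φ.normed (volume : Measure (Fin Q → ℝ))) := φ.integrable_normed
  have hφc : Continuous (φ.normed (volume : Measure (Fin Q → ℝ))) := φ.continuous_normed
  have hφs : HasCompactSupport (φ.normed (volume : Measure (Fin Q → ℝ))) :=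
    φ.hasCompactSupport_normed
  have hc : ∀ x, Integrable (fun t => φ.normed volume t • u (x - t)) := fun x =>
    (hφc.smul (hu.continuous.comp (by fun_prop))).integrable_of_hasCompactSupport hφs.smul_right
  refine LipschitzWith.of_dist_le_mul fun x y => ?_
  rw [dist_eq_norm]
  simp only [MeasureTheory.convolution, ContinuousLinearMap.lsmul_apply]
  rw [← integral_sub (hc x) (hc y)]
  calc ‖∫ t, (φ.normed volume t • u (x - t) - φ.normed volume t • u (y - t))‖
      ≤ ∫ t, φ.normed volume t * (K * dist x y) := by
        refine norm_integral_le_of_norm_le (hφi.mul_const _) (Eventually.of_forall fun t => ?_)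
        rw [← smul_sub, norm_smul, ← dist_eq_norm]
        have := hu.dist_le_mul (x - t) (y - t)
        rw [dist_sub_right] at this
        have h0 := φ.nonneg_normed (μ := volume) t
        rw [Real.norm_of_nonneg h0]
        gcongr
    _ = K * dist x y := by
        rw [integral_mul_const, φ.integral_normed, one_mul]

set_option synthInstance.maxHeartbeats 200000 in
set_option maxSynthPendingDepth 5 in
lemma mollify {K : NNReal} {u : (Fin Q → ℝ) → (Fin Q → ℝ)} (hu : LipschitzWith K u) :
    ∃ U : ℕ → (Fin Q → ℝ) → (Fin Q → ℝ), (∀ n, ContDiff ℝ 2 (U n)) ∧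
      (∀ n, LipschitzWith K (U n)) ∧
      (∀ n, ∃ C, ∀ w, ‖fderiv ℝ (fderiv ℝ (U n)) w‖ ≤ C) ∧
      (∀ w, Tendsto (fun n => U n w) atTop (𝓝 (u w))) ∧
      (∀ᵐ w, Tendsto (fun n => fderiv ℝ (U n) w) atTop (𝓝 (fderiv ℝ u w))) := by
  let φ : ℕ → ContDiffBump (0 : Fin Q → ℝ) := fun n =>
    ⟨(1 / ((n:ℝ) + 1)) / 2, 1 / ((n:ℝ) + 1), by positivity, half_lt_self (by positivity)⟩
  have hφ : Tendsto (fun n => (φ n).rOut) atTop (𝓝 0) := tendsto_one_div_add_atTop_nhds_zero_nat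
  have hφ2 : ∀ᶠ n in atTop, (φ n).rOut ≤ 2 * (φ n).rIn :=
    Eventually.of_forall fun n => by simp only [φ]; linarith
  have hbd : ∀ w, ‖fderiv ℝ u w‖ ≤ K := fun w => norm_fderiv_le_of_lipschitz ℝ hu
  have hli : LocallyIntegrable (fderiv ℝ u) (volume : Measure (Fin Q → ℝ)) := by
    refine (locallyIntegrable_const (K : ℝ)).mono
      (measurable_fderiv ℝ u).aestronglyMeasurable (Eventually.of_forall fun w => ?_)
    rw [NNReal.norm_eq]
    exact hbd w
  have hfd : ∀ n, fderiv ℝ ((φ n).normed volume ⋆[ContinuousLinearMap.lsmul ℝ ℝ, volume] u)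
      = ((φ n).normed volume ⋆[ContinuousLinearMap.lsmul ℝ ℝ, volume] (fderiv ℝ u)) :=
    fun n => funext fun x => (convo_fderiv hu (φ n) x).fderiv
  refine ⟨fun n => (φ n).normed volume ⋆[ContinuousLinearMap.lsmul ℝ ℝ, volume] u,
    fun n => ?_, fun n => convo_lip hu (φ n), fun n => ?_, fun w => ?_, ?_⟩
  · exact HasCompactSupport.contDiff_convolution_left (n := 2) _ (φ n).hasCompactSupport_normed
      (φ n).contDiff_normed hu.continuous.locallyIntegrable
  · have hcs : HasCompactSupport ((φ n).normed (volume : Measure (Fin Q → ℝ))) :=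
      (φ n).hasCompactSupport_normed
    have hcd : ContDiff ℝ 1 ((φ n).normed (volume : Measure (Fin Q → ℝ))) := (φ n).contDiff_normed
    have hi : Integrable (fderiv ℝ ((φ n).normed (volume : Measure (Fin Q → ℝ)))) :=
      (hcd.continuous_fderiv (by norm_num)).integrable_of_hasCompactSupport (hcs.fderiv ℝ)
    let L := (ContinuousLinearMap.lsmul ℝ ℝ :
      ℝ →L[ℝ] ((Fin Q → ℝ) →L[ℝ] (Fin Q → ℝ)) →L[ℝ] ((Fin Q → ℝ) →L[ℝ] (Fin Q → ℝ)))
    refine ⟨∫ t, ‖L.precompL (Fin Q → ℝ)‖ * ‖fderiv ℝ ((φ n).normed (volume : Measure (Fin Q → ℝ))) t‖ * K,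
      fun w => ?_⟩
    rw [hfd n, (hcs.hasFDerivAt_convolution_left L hcd hli w).fderiv]
    refine norm_integral_le_of_norm_le ((hi.norm.const_mul _).mul_const _)
      (Eventually.of_forall fun t => ?_)
    refine (ContinuousLinearMap.le_opNorm₂ _ _ _).trans ?_
    gcongr
    exact hbd _
  · exact ContDiffBump.convolution_tendsto_right_of_continuous hφ hu.continuous w
  · simp only [hfd]
    exact ContDiffBump.ae_convolution_tendsto_right_of_locallyIntegrable hφ hφ2 hli

lemma jacM_apply (f : (Fin Q → ℝ) → (Fin Q → ℝ)) (w : Fin Q → ℝ) (i j : Fin Q) :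
    jacM f w i j = fderiv ℝ f w (Pi.single j 1) i := by
  simp [jacM, LinearMap.toMatrix'_apply]

lemma norm_single_le (i : Fin Q) : ‖(Pi.single i (1:ℝ) : Fin Q → ℝ)‖ ≤ 1 := by
  refine (pi_norm_le_iff_of_nonneg zero_le_one).2 fun j => ?_
  rw [Pi.single_apply]
  split_ifs <;> simp

lemma pd_eq_jacM {f : (Fin Q → ℝ) → (Fin Q → ℝ)} (hf : Differentiable ℝ f) (i j : Fin Q) :
    pd j (fun w => f w i) = fun w => jacM f w i j := by
  funext w
  rw [jacM_apply]
  unfold pd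
  rw [((hasFDerivAt_pi'.1 (hf w).hasFDerivAt) i).fderiv]
  simp

lemma jacM_le {K : NNReal} {u : (Fin Q → ℝ) → (Fin Q → ℝ)} (hu : LipschitzWith K u)
    (w : Fin Q → ℝ) (i j : Fin Q) : |jacM u w i j| ≤ K := by
  rw [jacM_apply, ← Real.norm_eq_abs]
  calc _ ≤ ‖fderiv ℝ u w (Pi.single j 1)‖ := norm_le_pi_norm _ i
    _ ≤ ‖fderiv ℝ u w‖ * ‖(Pi.single j (1:ℝ) : Fin Q → ℝ)‖ := ContinuousLinearMap.le_opNorm _ _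
    _ ≤ K * 1 := by
        gcongr
        · exact norm_fderiv_le_of_lipschitz ℝ hu
        · exact norm_single_le j
    _ = K := mul_one _

lemma good_jac (hv : v ≠ 0) {K : NNReal} {U : ℕ → (Fin Q → ℝ) → (Fin Q → ℝ)}
    {u : (Fin Q → ℝ) → (Fin Q → ℝ)}
    (hU : ∀ n, LipschitzWith K (U n))
    (hl : ∀ᵐ w, Tendsto (fun n => fderiv ℝ (U n) w) atTop (𝓝 (fderiv ℝ u w))) (i j : Fin Q) :
    Good Q v (fun n w => jacM (U n) w i j) (fun w => jacM u w i j) := by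
  refine ⟨fun n => ?_, ⟨K, 0, K.2, fun n w => by simpa using jacM_le (hU n) w i j⟩, ?_⟩
  · simp only [jacM_apply]
    exact ((measurable_pi_apply i).comp
      (measurable_fderiv_apply_const ℝ (U n) (Pi.single j 1))).aestronglyMeasurable
  · filter_upwards [(gaussVec_ac Q v hv).ae_le hl] with w hw
    simp only [jacM_apply]
    have h1 := ((ContinuousLinearMap.apply ℝ (Fin Q → ℝ)
      (Pi.single j (1:ℝ) : Fin Q → ℝ)).continuous.tendsto (fderiv ℝ u w)).comp hw
    exact (tendsto_pi_nhds.1 h1) i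

lemma good_val {K : NNReal} {U : ℕ → (Fin Q → ℝ) → (Fin Q → ℝ)}
    {u : (Fin Q → ℝ) → (Fin Q → ℝ)}
    (hU : ∀ n, LipschitzWith K (U n))
    (hl : ∀ w, Tendsto (fun n => U n w) atTop (𝓝 (u w))) (i : Fin Q) :
    Good Q v (fun n w => U n w i) (fun w => u w i) := by
  refine ⟨fun n => ((continuous_apply i).comp (hU n).continuous).aestronglyMeasurable, ?_,
    Eventually.of_forall fun w => (tendsto_pi_nhds.1 (hl w)) i⟩
  obtain ⟨B, hB⟩ := (hl 0).norm.bddAbove_range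
  have hB' : ∀ n, ‖U n 0‖ ≤ B := fun n => hB ⟨n, rfl⟩
  have hB0 : 0 ≤ B := (norm_nonneg _).trans (hB' 0)
  refine ⟨B + K, 1, by positivity, fun n w => ?_⟩
  have h1 : |U n w i| ≤ ‖U n w‖ := norm_le_pi_norm (U n w) i
  have h2 := (hU n).dist_le_mul w 0
  rw [dist_eq_norm, dist_zero_right] at h2
  have h3 : ‖U n w‖ ≤ ‖U n w - U n 0‖ + ‖U n 0‖ := by
    simpa using norm_add_le (U n w - U n 0) (U n 0)
  have h4 := hB' n
  have h5 := norm_nonneg w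
  have h6 : 0 ≤ (K:ℝ) := K.2
  nlinarith

/-- divergence-type operator -/
noncomputable def psi (v : NNReal) (u : (Fin Q → ℝ) → (Fin Q → ℝ)) (w : Fin Q → ℝ) : ℝ :=
  ∑ i, (w i * u w i - v * jacM u w i i)

/-- integrand of the second order identity -/
noncomputable def Psi (v : NNReal) (u : (Fin Q → ℝ) → (Fin Q → ℝ)) (w : Fin Q → ℝ) : ℝ :=
  (psi v u w) ^ 2 - (v * ∑ i, u w i ^ 2 + v ^ 2 * ∑ i, ∑ j, jacM u w i j * jacM u w j i)

lemma smooth_psi (hv : v ≠ 0) {K : NNReal} {u : (Fin Q → ℝ) → (Fin Q → ℝ)}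
    (hu : LipschitzWith K u) (hc : ContDiff ℝ 2 u) :
    ∫ w, psi v u w ∂(gaussVec Q v) = 0 := by
  have hd : Differentiable ℝ u := hc.differentiable (by norm_num)
  have gv : ∀ i, PG Q v (fun w => u w i) := fun i =>
    good_val (U := fun _ => u) (fun _ => hu) (fun w => tendsto_const_nhds) i
  have gj : ∀ i j, PG Q v (fun w => jacM u w i j) := fun i j =>
    good_jac hv (U := fun _ => u) (fun _ => hu)
      (Eventually.of_forall fun w => tendsto_const_nhds) i j
  unfold psi
  rw [integral_finsetSum _ fun i _ => (((Good.coord i).mul (gv i)).sub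
    ((Good.const (v:ℝ)).mul (gj i i))).integrable 0]
  refine Finset.sum_eq_zero fun i _ => ?_
  have hdi : Differentiable ℝ (fun w => u w i) := fun w => differentiableAt_pi.1 (hd w) i
  have := ibp hv (fun w => u w i) i hdi (gv i) (by rw [pd_eq_jacM hd]; exact gj i i)
  rw [pd_eq_jacM hd] at this
  exact this

lemma smooth_Psi (hv : v ≠ 0) {K : NNReal} {u : (Fin Q → ℝ) → (Fin Q → ℝ)}
    (hu : LipschitzWith K u) (hc : ContDiff ℝ 2 u)
    (hb : ∃ C, ∀ w, ‖fderiv ℝ (fderiv ℝ u) w‖ ≤ C) :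
    ∫ w, Psi v u w ∂(gaussVec Q v) = 0 := by
  have hd : Differentiable ℝ u := hc.differentiable (by norm_num)
  have gv : ∀ i, PG Q v (fun w => u w i) := fun i =>
    good_val (U := fun _ => u) (fun _ => hu) (fun w => tendsto_const_nhds) i
  have gj : ∀ i j, PG Q v (fun w => jacM u w i j) := fun i j =>
    good_jac hv (U := fun _ => u) (fun _ => hu)
      (Eventually.of_forall fun w => tendsto_const_nhds) i j
  have hci : ∀ i, ContDiff ℝ 2 (fun w => u w i) := fun i => contDiff_pi.1 hc i
  have gpd : ∀ k i, PG Q v (pd i (fun w => u w k)) := fun k i => by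
    rw [pd_eq_jacM hd]; exact gj k i
  have gpd2 : ∀ k i j, PG Q v (pd i (pd j (fun w => u w k))) := by
    intro k i j
    obtain ⟨C, hC⟩ := hb
    have hC0 : 0 ≤ C := (norm_nonneg (fderiv ℝ (fderiv ℝ u) 0)).trans (hC 0)
    have hdd : Differentiable ℝ (fderiv ℝ u) :=
      (hc.fderiv_right (m := 1) (by norm_num)).differentiable (by norm_num)
    have hcont : Continuous (pd i (pd j (fun w => u w k))) := by
      have h1 := pd_contDiff (hci k) j
      unfold pd at h1 ⊢
      exact (h1.continuous_fderiv (by norm_num)).clm_apply continuous_const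
    refine ⟨fun _ => hcont.aestronglyMeasurable, ⟨C, 0, hC0, fun _ w => ?_⟩,
      Eventually.of_forall fun w => tendsto_const_nhds⟩
    have hform : pd i (pd j (fun w => u w k)) w
        = fderiv ℝ (fderiv ℝ u) w (Pi.single i 1) (Pi.single j 1) k := by
      rw [pd_eq_jacM hd]
      simp only [jacM_apply]
      have hdj : Differentiable ℝ (fun w => fderiv ℝ u w (Pi.single j 1)) :=
        fun w => (hdd w).clm_apply (differentiableAt_const _)
      rw [pd_eq_jacM hdj]
      simp only [jacM_apply]
      rw [fderiv_clm_apply (hdd w) (differentiableAt_const _)]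
      simp
    rw [hform, ← Real.norm_eq_abs, pow_zero, mul_one]
    calc _ ≤ ‖fderiv ℝ (fderiv ℝ u) w (Pi.single i 1) (Pi.single j 1)‖ := norm_le_pi_norm _ k
      _ ≤ ‖fderiv ℝ (fderiv ℝ u) w‖ * ‖(Pi.single i (1:ℝ) : Fin Q → ℝ)‖
            * ‖(Pi.single j (1:ℝ) : Fin Q → ℝ)‖ := ContinuousLinearMap.le_opNorm₂ _ _ _
      _ ≤ C * 1 * 1 := by
          gcongr
          · exact hC w
          · exact norm_single_le i
          · exact norm_single_le j
      _ = C := by ring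
  have hsec : ∀ i j : Fin Q, _ := fun i j => second hv (hci i) (hci j) (gv i) (gpd i) (gv j)
    (gpd j) (gpd2 j) i j
  have hInt2 : ∀ i j : Fin Q, Integrable (fun w => ((w i * u w i - v * jacM u w i i)
      * (w j * u w j - v * jacM u w j j)
      - (v * (if i = j then 1 else 0) * (u w i * u w j) + v ^ 2 * (jacM u w i j * jacM u w j i))))
        (gaussVec Q v) := fun i j =>
    (((((Good.coord i).mul (gv i)).sub ((Good.const (v:ℝ)).mul (gj i i))).mul
      (((Good.coord j).mul (gv j)).sub ((Good.const (v:ℝ)).mul (gj j j)))).sub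
      (((Good.const _).mul ((gv i).mul (gv j))).add
        ((Good.const _).mul ((gj i j).mul (gj j i))))).integrable 0
  have hP : ∀ w, Psi v u w = ∑ i, ∑ j, ((w i * u w i - v * jacM u w i i)
      * (w j * u w j - v * jacM u w j j)
      - (v * (if i = j then 1 else 0) * (u w i * u w j)
        + v ^ 2 * (jacM u w i j * jacM u w j i))) := by
    intro w
    unfold Psi psi
    rw [sq, Finset.sum_mul_sum]
    simp only [Finset.sum_sub_distrib, Finset.sum_add_distrib, Finset.mul_sum]
    congr 2
    refine Finset.sum_congr rfl fun i _ => ?_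
    simp [sq]
  rw [integral_congr_ae (Eventually.of_forall hP),
    integral_finsetSum _ fun i _ => integrable_finsetSum _ fun j _ => hInt2 i j]
  refine Finset.sum_eq_zero fun i _ => ?_
  rw [integral_finsetSum _ fun j _ => hInt2 i j]
  refine Finset.sum_eq_zero fun j _ => ?_
  have := hsec i j
  simp only [pd_eq_jacM hd] at this
  exact this

lemma lip_identities (hv : v ≠ 0) {K : NNReal} {u : (Fin Q → ℝ) → (Fin Q → ℝ)}
    (hu : LipschitzWith K u) :
    ∫ w, psi v u w ∂(gaussVec Q v) = 0 ∧ ∫ w, Psi v u w ∂(gaussVec Q v) = 0 := by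
  obtain ⟨U, hc, hl, hb, ht, ht'⟩ := mollify hu
  have gv := fun i => good_val (v := v) hl ht i
  have gj := fun i j => good_jac hv hl ht' i j
  have g1 : Good Q v (fun n => psi v (U n)) (psi v u) := by
    unfold psi
    exact Good.sum _ fun i => ((Good.coord i).mul (gv i)).sub ((Good.const (v:ℝ)).mul (gj i i))
  have g2 : Good Q v (fun n => Psi v (U n)) (Psi v u) := by
    unfold Psi
    exact g1.sq.sub (((Good.const _).mul (Good.sum _ fun i => (gv i).sq)).add
      ((Good.const _).mul (Good.sum _ fun i => Good.sum _ fun j => (gj i j).mul (gj j i))))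
  constructor
  · refine tendsto_nhds_unique g1.tendsto ?_
    simp only [fun n => smooth_psi hv (hl n) (hc n)]
    exact tendsto_const_nhds
  · refine tendsto_nhds_unique g2.tendsto ?_
    simp only [fun n => smooth_Psi hv (hl n) (hc n) (hb n)]
    exact tendsto_const_nhds

lemma affine_field (C : Matrix (Fin Q) (Fin Q) ℝ) (c : ℝ) {K : NNReal}
    {g : (Fin Q → ℝ) → (Fin Q → ℝ)} (hg : LipschitzWith K g) :
    (∃ K', LipschitzWith K' (fun w => C *ᵥ (w + c • g w))) ∧
    ∀ w, DifferentiableAt ℝ g w →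
      jacM (fun w => C *ᵥ (w + c • g w)) w = C * (1 + c • jacM g w) := by
  let L : (Fin Q → ℝ) →L[ℝ] (Fin Q → ℝ) := LinearMap.toContinuousLinearMap (Matrix.mulVecLin C)
  constructor
  · refine ⟨_, L.lipschitz.comp (LipschitzWith.id.add ((lipschitzWith_smul c).comp hg))⟩
  · intro w hw
    have h1 : HasFDerivAt (fun w => C *ᵥ (w + c • g w))
        (L.comp (ContinuousLinearMap.id ℝ _ + c • fderiv ℝ g w)) w :=
      L.hasFDerivAt.comp w ((hasFDerivAt_id w).add (hw.hasFDerivAt.fun_const_smul c))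
    have h2 : (L : (Fin Q → ℝ) →ₗ[ℝ] (Fin Q → ℝ)) = Matrix.toLin' C := by
      ext; simp [L]
    unfold jacM
    rw [h1.fderiv]
    simp only [ContinuousLinearMap.toLinearMap_comp, ContinuousLinearMap.toLinearMap_add,
      ContinuousLinearMap.toLinearMap_smul]
    rw [h2, LinearMap.toMatrix'_comp, LinearMap.toMatrix'_toLin', map_add, map_smul,
      ContinuousLinearMap.coe_id, LinearMap.toMatrix'_id]

lemma psi_eq (u : (Fin Q → ℝ) → (Fin Q → ℝ)) (w : Fin Q → ℝ) :
    psi v u w = w ⬝ᵥ u w - v * (jacM u w).trace := by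
  simp [psi, dotProduct, Matrix.trace, Finset.sum_sub_distrib, Finset.mul_sum]

lemma Psi_eq (u : (Fin Q → ℝ) → (Fin Q → ℝ)) (w : Fin Q → ℝ) :
    Psi v u w = (w ⬝ᵥ u w - v * (jacM u w).trace) ^ 2
      - (v * (u w ⬝ᵥ u w) + v ^ 2 * (jacM u w * jacM u w).trace) := by
  rw [Psi, psi_eq]
  simp [dotProduct, Matrix.trace, Matrix.mul_apply, sq]

lemma pointwise {M : ℕ} (A : Matrix (Fin M) (Fin Q) ℝ) (s : ℝ) (w g : Fin Q → ℝ)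
    (J : Matrix (Fin Q) (Fin Q) ℝ) :
    ((∑ i, (A *ᵥ (w + g)) i ^ 2 - s * (Aᵀ * A).trace + 2 * s * (A * J * Aᵀ).trace)
      - ∑ i, (A *ᵥ g) i ^ 2) ^ 2
    = ((w ⬝ᵥ ((Aᵀ * A) *ᵥ (w + (2:ℝ) • g)) - s * ((Aᵀ * A) * (1 + (2:ℝ) • (-J))).trace) ^ 2
      - (s * (((Aᵀ * A) *ᵥ (w + (2:ℝ) • g)) ⬝ᵥ ((Aᵀ * A) *ᵥ (w + (2:ℝ) • g)))
        + s ^ 2 * (((Aᵀ * A) * (1 + (2:ℝ) • (-J))) * ((Aᵀ * A) * (1 + (2:ℝ) • (-J)))).trace))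
      + s * (w ⬝ᵥ ((Aᵀ * A * (Aᵀ * A)) *ᵥ (w + (4:ℝ) • g))
        - s * ((Aᵀ * A * (Aᵀ * A)) * (1 + (4:ℝ) • (-J))).trace)
      + (2 * s ^ 2 * ((Aᵀ * A) ^ 2).trace + 4 * s * ∑ i, ((Aᵀ * A) *ᵥ g) i ^ 2
        - 4 * s ^ 2 * (A * J * Aᵀ * A * ((2:ℝ) • (1 : Matrix (Fin Q) (Fin Q) ℝ) - J) * Aᵀ).trace)
      := by
  have hsq : ∀ {n : ℕ} (x : Fin n → ℝ), ∑ i, x i ^ 2 = x ⬝ᵥ x := by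
    intro n x; simp [dotProduct, sq]
  have t1 : (A * J * Aᵀ).trace = (Aᵀ * A * J).trace := by
    rw [Matrix.trace_mul_comm, ← Matrix.mul_assoc]
  have t2 : (A * J * Aᵀ * A * ((2:ℝ) • (1 : Matrix (Fin Q) (Fin Q) ℝ) - J) * Aᵀ).trace
      = (Aᵀ * A * J * (Aᵀ * A) * ((2:ℝ) • (1 : Matrix (Fin Q) (Fin Q) ℝ) - J)).trace := by
    rw [Matrix.trace_mul_comm]
    simp only [Matrix.mul_assoc]
  have q1 : ∀ x y : Fin Q → ℝ, (A *ᵥ x) ⬝ᵥ (A *ᵥ y) = x ⬝ᵥ ((Aᵀ * A) *ᵥ y) := by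
    intro x y
    rw [← Matrix.mulVec_mulVec, Matrix.dotProduct_mulVec x, Matrix.vecMul_transpose]
  have hB : (Aᵀ * A)ᵀ = Aᵀ * A := by simp [Matrix.transpose_mul]
  simp only [hsq]
  rw [t1, t2, q1, q1]
  generalize Aᵀ * A = B at *
  have q2 : ∀ x y : Fin Q → ℝ, x ⬝ᵥ ((B * B) *ᵥ y) = (B *ᵥ x) ⬝ᵥ (B *ᵥ y) := by
    intro x y
    rw [← Matrix.mulVec_mulVec, Matrix.dotProduct_mulVec x, ← Matrix.mulVec_transpose, hB]
  have q3 : ∀ x y : Fin Q → ℝ, x ⬝ᵥ (B *ᵥ y) = y ⬝ᵥ (B *ᵥ x) := by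
    intro x y
    rw [Matrix.dotProduct_mulVec x, ← Matrix.mulVec_transpose, hB, dotProduct_comm]
  have t3 : (B * J * B).trace = (B * B * J).trace := by
    rw [Matrix.trace_mul_comm, ← Matrix.mul_assoc]
  rw [q2]
  simp only [Matrix.mulVec_add, Matrix.mulVec_smul, dotProduct_add, add_dotProduct,
    dotProduct_smul, smul_dotProduct, smul_eq_mul, q3 g w, dotProduct_comm (B *ᵥ g) (B *ᵥ w),
    Matrix.mul_add, Matrix.add_mul, Matrix.mul_sub, Matrix.trace_add, Matrix.trace_sub,
    Matrix.mul_smul, Matrix.smul_mul, Matrix.mul_neg, Matrix.neg_mul, Matrix.trace_smul,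
    Matrix.trace_neg, Matrix.mul_one, smul_neg, pow_two B, t3, ← Matrix.mul_assoc]
  ring

lemma split_integral {μ : Measure (Fin Q → ℝ)} {a b c d e : (Fin Q → ℝ) → ℝ}
    (ha : Integrable a μ) (hb : Integrable b μ) (hc : Integrable c μ) (hd : Integrable d μ)
    (he : Integrable e μ) :
    ∫ w, ((a w + b w) + (c w + d w - e w)) ∂μ
      = (∫ w, a w ∂μ + ∫ w, b w ∂μ) + (∫ w, c w ∂μ + ∫ w, d w ∂μ - ∫ w, e w ∂μ) := by
  have h1 : Integrable (fun w => a w + b w) μ := ha.add hb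
  have h2 : Integrable (fun w => c w + d w) μ := hc.add hd
  have h3 : Integrable (fun w => c w + d w - e w) μ := h2.sub he
  rw [integral_add h1 h3, integral_add ha hb, integral_sub h2 he, integral_add hc hd]

lemma mul_PG {m n p : ℕ} {F : (Fin Q → ℝ) → Matrix (Fin m) (Fin n) ℝ}
    {G : (Fin Q → ℝ) → Matrix (Fin n) (Fin p) ℝ}
    (hF : ∀ i j, PG Q v (fun w => F w i j)) (hG : ∀ i j, PG Q v (fun w => G w i j)) :
    ∀ i j, PG Q v (fun w => (F w * G w) i j) := by
  intro i j
  simp only [Matrix.mul_apply]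
  exact Good.sum _ fun k => (hF i k).mul (hG k j)

lemma val_PG {K : NNReal} {u : (Fin Q → ℝ) → (Fin Q → ℝ)} (hu : LipschitzWith K u) (i : Fin Q) :
    PG Q v (fun w => u w i) :=
  good_val (U := fun _ => u) (fun _ => hu) (fun _ => tendsto_const_nhds) i

lemma jac_PG (hv : v ≠ 0) {K : NNReal} {u : (Fin Q → ℝ) → (Fin Q → ℝ)} (hu : LipschitzWith K u)
    (i j : Fin Q) : PG Q v (fun w => jacM u w i j) :=
  good_jac hv (U := fun _ => u) (fun _ => hu)
    (Eventually.of_forall fun _ => tendsto_const_nhds) i j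

lemma psi_PG (hv : v ≠ 0) {K : NNReal} {u : (Fin Q → ℝ) → (Fin Q → ℝ)} (hu : LipschitzWith K u) :
    PG Q v (psi v u) := by
  unfold psi
  exact Good.sum _ fun i => ((Good.coord i).mul (val_PG hu i)).sub
    ((Good.const (v:ℝ)).mul (jac_PG hv hu i i))

lemma Psi_PG (hv : v ≠ 0) {K : NNReal} {u : (Fin Q → ℝ) → (Fin Q → ℝ)} (hu : LipschitzWith K u) :
    PG Q v (Psi v u) := by
  unfold Psi
  exact (psi_PG hv hu).sq.sub (((Good.const _).mul (Good.sum _ fun i => (val_PG hu i).sq)).add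
    ((Good.const _).mul (Good.sum _ fun i => Good.sum _ fun j =>
      (jac_PG hv hu i j).mul (jac_PG hv hu j i))))

end GS

/-- Reliability of the GSURE: expression for the expected squared error between
`GSURE^A(y)` and the true squared error `SE^A(y) = ‖Aμ₀ − Aμ̂(y)‖₂²`. -/
theorem gsure_reliability
    {N Q M : ℕ} (hN : 0 < N) (hQ : 0 < Q) (hM : 0 < M)
    (Φ : Matrix (Fin Q) (Fin N) ℝ) (x0 : Fin N → ℝ) (σ : ℝ) (hσ : 0 < σ)
    (xhat : (Fin Q → ℝ) → (Fin N → ℝ))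
    (muHat : (Fin Q → ℝ) → (Fin Q → ℝ))
    (hmuHat : ∀ y, muHat y = Φ.mulVec (xhat y))
    (K : NNReal) (hlip : LipschitzWith K muHat)
    (A : Matrix (Fin M) (Fin Q) ℝ)
    (μ : Measure (Fin Q → ℝ)) (hμ : μ = gaussVec Q ⟨σ ^ 2, sq_nonneg σ⟩) :
    ∫ w, (GSURE A σ muHat (Φ.mulVec x0 + w)
          - ∑ i, (A.mulVec (Φ.mulVec x0 - muHat (Φ.mulVec x0 + w)) i) ^ 2) ^ 2 ∂μ
      = 2 * σ ^ 4 * ((Aᵀ * A) ^ 2).trace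
        + 4 * σ ^ 2 *
            ∫ w, ∑ i, ((Aᵀ * A).mulVec (Φ.mulVec x0 - muHat (Φ.mulVec x0 + w)) i) ^ 2 ∂μ
        - 4 * σ ^ 4 *
            ∫ w, (A * jacM muHat (Φ.mulVec x0 + w) * Aᵀ * A *
                ((2 : ℝ) • (1 : Matrix (Fin Q) (Fin Q) ℝ)
                  - jacM muHat (Φ.mulVec x0 + w)) * Aᵀ).trace ∂μ := by
  have hσ2 : (⟨σ ^ 2, sq_nonneg σ⟩ : NNReal) ≠ 0 := by
    intro h
    have h2 : σ ^ 2 = 0 := congrArg NNReal.toReal h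
    exact hσ.ne' (pow_eq_zero_iff (two_ne_zero) |>.1 h2)
  subst hμ
  obtain ⟨v, hvdef⟩ : ∃ v : NNReal, v = ⟨σ ^ 2, sq_nonneg σ⟩ := ⟨_, rfl⟩
  have hvs : (v : ℝ) = σ ^ 2 := by rw [hvdef]; rfl
  rw [← hvdef] at hσ2 ⊢
  set m := Φ.mulVec x0 with hm
  let g : (Fin Q → ℝ) → (Fin Q → ℝ) := fun w => m - muHat (m + w)
  have hg : LipschitzWith K g := by
    refine LipschitzWith.of_dist_le_mul fun x y => ?_
    have := hlip.dist_le_mul (m + x) (m + y)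
    rw [dist_add_left] at this
    simp only [g]
    rw [dist_sub_left]
    exact this
  have hJ : ∀ w, jacM g w = - jacM muHat (m + w) := by
    intro w
    simp only [jacM, g]
    rw [fderiv_const_sub, fderiv_comp_add_left]
    ext i j
    simp [LinearMap.toMatrix'_apply]
  obtain ⟨⟨K1, hu⟩, hju⟩ := GS.affine_field (Aᵀ * A) 2 hg
  obtain ⟨⟨K2, hz⟩, hjz⟩ := GS.affine_field (Aᵀ * A * (Aᵀ * A)) 4 hg
  have hdiff : ∀ᵐ w ∂(gaussVec Q v), DifferentiableAt ℝ g w :=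
    (GS.gaussVec_ac Q v hσ2).ae_le hg.ae_differentiableAt
  have hJP : ∀ i j, GS.PG Q v (fun w => jacM muHat (m + w) i j) := by
    intro i j
    have h := (GS.Good.const (-1)).mul (GS.jac_PG hσ2 hg i j)
    simpa [hJ] using h
  have hc : ∀ {a b : ℕ} (C : Matrix (Fin a) (Fin b) ℝ) (i j), GS.PG Q v (fun _ => C i j) :=
    fun C i j => GS.Good.const _
  have hS : GS.PG Q v (fun w => ∑ i, ((Aᵀ * A).mulVec (m - muHat (m + w)) i) ^ 2) := by
    simp only [Matrix.mulVec, dotProduct]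
    exact GS.Good.sum _ fun i => (GS.Good.sum _ fun j => (hc (Aᵀ * A) i j).mul (GS.val_PG hg j)).sq
  have h2J : ∀ i j, GS.PG Q v (fun w => ((2 : ℝ) • (1 : Matrix (Fin Q) (Fin Q) ℝ)
      - jacM muHat (m + w)) i j) := by
    intro i j
    simp only [Matrix.sub_apply]
    exact (hc ((2 : ℝ) • (1 : Matrix (Fin Q) (Fin Q) ℝ)) i j).sub (hJP i j)
  have hT : GS.PG Q v (fun w => (A * jacM muHat (m + w) * Aᵀ * A *
      ((2 : ℝ) • (1 : Matrix (Fin Q) (Fin Q) ℝ) - jacM muHat (m + w)) * Aᵀ).trace) := by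
    unfold Matrix.trace
    exact GS.Good.sum _ fun i => (GS.mul_PG (GS.mul_PG (GS.mul_PG (GS.mul_PG (GS.mul_PG (hc A) hJP)
      (hc Aᵀ)) (hc A)) h2J) (hc Aᵀ)) i i
  have i1 := (GS.Psi_PG hσ2 hu).integrable 0
  have i2 := ((GS.psi_PG hσ2 hz).integrable 0).const_mul (σ ^ 2)
  have i3 := (hS.integrable 0).const_mul (4 * σ ^ 2)
  have i4 := (hT.integrable 0).const_mul (4 * σ ^ 4)
  have e1 := (GS.lip_identities hσ2 hu).2
  have e2 := (GS.lip_identities hσ2 hz).1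
  have key : ∀ᵐ w ∂(gaussVec Q v), (GSURE A σ muHat (m + w)
          - ∑ i, (A.mulVec (m - muHat (m + w)) i) ^ 2) ^ 2
      = (GS.Psi v (fun w => (Aᵀ * A) *ᵥ (w + (2:ℝ) • g w)) w
        + σ ^ 2 * GS.psi v (fun w => (Aᵀ * A * (Aᵀ * A)) *ᵥ (w + (4:ℝ) • g w)) w)
        + (2 * σ ^ 4 * ((Aᵀ * A) ^ 2).trace
          + 4 * σ ^ 2 * ∑ i, ((Aᵀ * A).mulVec (m - muHat (m + w)) i) ^ 2
          - 4 * σ ^ 4 * (A * jacM muHat (m + w) * Aᵀ * A *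
                ((2 : ℝ) • (1 : Matrix (Fin Q) (Fin Q) ℝ) - jacM muHat (m + w)) * Aᵀ).trace) := by
    filter_upwards [hdiff] with w hw
    have hp := GS.pointwise A (σ ^ 2) w (g w) (jacM muHat (m + w))
    rw [GS.Psi_eq, GS.psi_eq, hju w hw, hjz w hw, hJ w, hvs]
    have hy : m + w - muHat (m + w) = w + g w := by
      simp only [g]; abel
    have h4 : σ ^ 4 = (σ ^ 2) ^ 2 := by ring
    unfold GSURE
    rw [hy, h4]
    exact hp
  rw [integral_congr_ae key]
  have ic : Integrable (fun _ : Fin Q → ℝ => 2 * σ ^ 4 * ((Aᵀ * A) ^ 2).trace) (gaussVec Q v) :=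
    integrable_const _
  have hfin := GS.split_integral i1 i2 ic i3 i4
  rw [hfin, integral_const_mul, e1, e2, integral_const_mul, integral_const_mul, integral_const]
  simp
  exact integral_const_mul _ _
end

section
/- Fix λ > 0 and A ∈ ℝ^{M×Q}, and take as estimator the analysis lasso prediction μ̂ = μ_λ (assumed Lipschitz continuous). Then E_w[(GSURE^A(y) − SE^A(y))²] ≤ σ⁴ Q² ‖A‖⁴ (18/Q + 8 ‖μ₀‖₂²/(σ² Q²)), where ‖A‖ is the spectral norm of A. In particular, if ‖A‖ is bounded independently of Q, the relative reliability E_w[((GSURE^A(y) − SE^A(y))/(Q σ²))²] is O(1/Q). -/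
open Matrix MeasureTheory ProbabilityTheory

/-- The analysis lasso objective `L_{y,λ}(x) = (1/2)‖y − Φx‖₂² + λ‖D*x‖₁`. -/
noncomputable def lassoObj {N Q P : ℕ} (Φ : Matrix (Fin Q) (Fin N) ℝ)
    (D : Matrix (Fin N) (Fin P) ℝ) (y : Fin Q → ℝ) (lam : ℝ) (x : Fin N → ℝ) : ℝ :=
  (1 / 2) * ∑ i, (y i - Φ.mulVec x i) ^ 2 + lam * ∑ j, |Dᵀ.mulVec x j|

/-- `x` is a solution of `(P_λ(y))`, i.e. a global minimizer of the lasso objective. -/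
def IsLassoSol {N Q P : ℕ} (Φ : Matrix (Fin Q) (Fin N) ℝ)
    (D : Matrix (Fin N) (Fin P) ℝ) (y : Fin Q → ℝ) (lam : ℝ) (x : Fin N → ℝ) : Prop :=
  ∀ x' : Fin N → ℝ, lassoObj Φ D y lam x ≤ lassoObj Φ D y lam x'

/-- The spectral norm (ℓ²-operator norm) of a matrix. -/
noncomputable def specNorm {M Q : ℕ} (A : Matrix (Fin M) (Fin Q) ℝ) : ℝ :=
  ‖LinearMap.toContinuousLinearMap (Matrix.toEuclideanLin A)‖


/-! ### Lasso: existence of minimizers and firm nonexpansiveness -/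

lemma lasso_exists {N Q P : ℕ} (Φ : Matrix (Fin Q) (Fin N) ℝ) (D : Matrix (Fin N) (Fin P) ℝ)
    (hH0 : ∀ x : Fin N → ℝ, Φ.mulVec x = 0 → Dᵀ.mulVec x = 0 → x = 0)
    (lam : ℝ) (hlam : 0 < lam) (y : Fin Q → ℝ) :
    ∃ x, IsLassoSol Φ D y lam x := by
  let T : (Fin N → ℝ) →ₗ[ℝ] (Fin Q → ℝ) × (Fin P → ℝ) :=
    (Matrix.mulVecLin Φ).prod (Matrix.mulVecLin Dᵀ)
  have hT : LinearMap.ker T = ⊥ := by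
    rw [LinearMap.ker_eq_bot']
    intro x hx
    have h1 : Φ.mulVec x = 0 := congrArg Prod.fst hx
    have h2 : Dᵀ.mulVec x = 0 := congrArg Prod.snd hx
    exact hH0 x h1 h2
  obtain ⟨K, hK, hanti⟩ := T.exists_antilipschitzWith hT
  have hcont : Continuous (lassoObj Φ D y lam) := by
    have h1 : Continuous (fun x : Fin N → ℝ => Φ.mulVec x) := by fun_prop
    have h2 : Continuous (fun x : Fin N → ℝ => Dᵀ.mulVec x) := by fun_prop
    unfold lassoObj
    fun_prop
  have htend : Filter.Tendsto (fun x => ‖T x‖) (Filter.cocompact (Fin N → ℝ)) Filter.atTop := by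
    rw [← Metric.cobounded_eq_cocompact]
    exact tendsto_norm_cobounded_atTop.comp hanti.tendsto_cobounded
  have hbound : ∀ x, min 1 lam * ‖T x‖ - (‖y‖ + 1) ≤ lassoObj Φ D y lam x := by
    intro x
    have hm0 : 0 ≤ min 1 lam := le_min zero_le_one hlam.le
    have hm1 : min 1 lam ≤ 1 := min_le_left _ _
    have hm2 : min 1 lam ≤ lam := min_le_right _ _
    have hs1 : 0 ≤ ∑ i, (y i - Φ.mulVec x i) ^ 2 := Finset.sum_nonneg fun i _ => sq_nonneg _
    have hs2 : 0 ≤ ∑ j, |Dᵀ.mulVec x j| := Finset.sum_nonneg fun i _ => abs_nonneg _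
    have hTx : ‖T x‖ = max ‖Φ.mulVec x‖ ‖Dᵀ.mulVec x‖ := rfl
    have ha : ‖Φ.mulVec x‖ ≤ (1/2) * ∑ i, (y i - Φ.mulVec x i) ^ 2 + (‖y‖ + 1) := by
      have hr : 0 ≤ (1/2) * ∑ i, (y i - Φ.mulVec x i) ^ 2 + (‖y‖ + 1) := by positivity
      rw [pi_norm_le_iff_of_nonneg hr]
      intro i
      have h1 : (y i - Φ.mulVec x i) ^ 2 ≤ ∑ i, (y i - Φ.mulVec x i) ^ 2 :=
        Finset.single_le_sum (f := fun i => (y i - Φ.mulVec x i) ^ 2)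
          (fun i _ => sq_nonneg _) (Finset.mem_univ i)
      have h2 : |y i| ≤ ‖y‖ := norm_le_pi_norm y i
      rw [Real.norm_eq_abs]
      have h3 := abs_le.1 h2
      rw [abs_le]
      constructor <;> nlinarith [sq_nonneg (y i - Φ.mulVec x i - 1),
        sq_nonneg (y i - Φ.mulVec x i + 1)]
    have hb : ‖Dᵀ.mulVec x‖ ≤ ∑ j, |Dᵀ.mulVec x j| := by
      rw [pi_norm_le_iff_of_nonneg hs2]
      intro j
      exact Finset.single_le_sum (f := fun j => |Dᵀ.mulVec x j|)
          (fun i _ => abs_nonneg _) (Finset.mem_univ j)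
    unfold lassoObj
    rw [hTx]
    have hn := norm_nonneg y
    rcases max_cases ‖Φ.mulVec x‖ ‖Dᵀ.mulVec x‖ with ⟨h, _⟩ | ⟨h, _⟩ <;> rw [h]
    · have : min 1 lam * ‖Φ.mulVec x‖ ≤ 1 * ‖Φ.mulVec x‖ := by gcongr
      have : 0 ≤ lam * ∑ j, |Dᵀ.mulVec x j| := by positivity
      linarith
    · have : min 1 lam * ‖Dᵀ.mulVec x‖ ≤ lam * ∑ j, |Dᵀ.mulVec x j| := by gcongr
      linarith
  have hpos : 0 < min 1 lam := lt_min zero_lt_one hlam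
  have htend2 : Filter.Tendsto (lassoObj Φ D y lam) (Filter.cocompact (Fin N → ℝ))
      Filter.atTop := by
    refine Filter.tendsto_atTop_mono hbound ?_
    exact Filter.tendsto_atTop_add_const_right _ _ (htend.const_mul_atTop hpos)
  exact hcont.exists_forall_le htend2

lemma lasso_var_ineq {N Q P : ℕ} (Φ : Matrix (Fin Q) (Fin N) ℝ) (D : Matrix (Fin N) (Fin P) ℝ)
    (lam : ℝ) (hlam : 0 < lam) (y : Fin Q → ℝ) (x z : Fin N → ℝ)
    (hx : IsLassoSol Φ D y lam x) :
    ∑ i, (y i - Φ.mulVec x i) * (Φ.mulVec z i - Φ.mulVec x i)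
      ≤ lam * ∑ j, |Dᵀ.mulVec z j| - lam * ∑ j, |Dᵀ.mulVec x j| := by
  set a := ∑ i, (y i - Φ.mulVec x i) * (Φ.mulVec z i - Φ.mulVec x i) with ha
  set b := ∑ i, (Φ.mulVec z i - Φ.mulVec x i) ^ 2 with hb
  have hb0 : 0 ≤ b := Finset.sum_nonneg fun i _ => sq_nonneg _
  set c := lam * ∑ j, |Dᵀ.mulVec z j| - lam * ∑ j, |Dᵀ.mulVec x j| with hc
  have key : ∀ t : ℝ, 0 < t → t ≤ 1 → a ≤ c + t * b / 2 := by
    intro t ht ht1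
    have h := hx (x + t • (z - x))
    unfold lassoObj at h
    have e1 : ∑ i, (y i - Φ.mulVec (x + t • (z - x)) i) ^ 2
        = ∑ i, (y i - Φ.mulVec x i) ^ 2 - 2 * t * a + t ^ 2 * b := by
      rw [ha, hb, Finset.mul_sum, Finset.mul_sum, ← Finset.sum_sub_distrib,
        ← Finset.sum_add_distrib]
      refine Finset.sum_congr rfl fun i _ => ?_
      simp only [Matrix.mulVec_add, Matrix.mulVec_smul, Matrix.mulVec_sub, Pi.add_apply,
        Pi.smul_apply, Pi.sub_apply, smul_eq_mul]
      ring
    have e2 : ∑ j, |Dᵀ.mulVec (x + t • (z - x)) j|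
        ≤ (1 - t) * ∑ j, |Dᵀ.mulVec x j| + t * ∑ j, |Dᵀ.mulVec z j| := by
      rw [Finset.mul_sum, Finset.mul_sum, ← Finset.sum_add_distrib]
      refine Finset.sum_le_sum fun j _ => ?_
      have e3 : Dᵀ.mulVec (x + t • (z - x)) j
          = (1 - t) * Dᵀ.mulVec x j + t * Dᵀ.mulVec z j := by
        simp only [Matrix.mulVec_add, Matrix.mulVec_smul, Matrix.mulVec_sub, Pi.add_apply,
          Pi.smul_apply, Pi.sub_apply, smul_eq_mul]
        ring
      rw [e3]
      refine (abs_add_le _ _).trans ?_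
      rw [abs_mul, abs_mul, abs_of_nonneg (by linarith : 0 ≤ 1 - t), abs_of_pos ht]
    have e4 := mul_le_mul_of_nonneg_left e2 hlam.le
    rw [e1] at h
    have h5 : t * a ≤ t * (c + t * b / 2) := by
      rw [hc]; nlinarith
    exact le_of_mul_le_mul_left h5 ht
  by_contra! hcon
  have h1 := key (min 1 ((a - c) / (b + 1))) (lt_min one_pos (div_pos (by linarith) (by linarith)))
    (min_le_left _ _)
  have h2 : min 1 ((a - c) / (b + 1)) * b ≤ (a - c) / (b + 1) * b := by
    gcongr; exact min_le_right _ _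
  have h3 : (a - c) / (b + 1) * b ≤ a - c := by
    rw [div_mul_eq_mul_div, div_le_iff₀ (by linarith)]
    nlinarith
  linarith

lemma lasso_nonexp {N Q P : ℕ} (Φ : Matrix (Fin Q) (Fin N) ℝ) (D : Matrix (Fin N) (Fin P) ℝ)
    (hH0 : ∀ x : Fin N → ℝ, Φ.mulVec x = 0 → Dᵀ.mulVec x = 0 → x = 0)
    (lam : ℝ) (hlam : 0 < lam)
    (mu : (Fin Q → ℝ) → (Fin Q → ℝ))
    (hmu : ∀ y x, IsLassoSol Φ D y lam x → mu y = Φ.mulVec x) (y y' : Fin Q → ℝ) :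
    ∑ i, ((y i - 2 * mu y i) - (y' i - 2 * mu y' i)) ^ 2 ≤ ∑ i, (y i - y' i) ^ 2 := by
  obtain ⟨x, hx⟩ := lasso_exists Φ D hH0 lam hlam y
  obtain ⟨x', hx'⟩ := lasso_exists Φ D hH0 lam hlam y'
  have h1 := lasso_var_ineq Φ D lam hlam y x x' hx
  have h2 := lasso_var_ineq Φ D lam hlam y' x' x hx'
  rw [← hmu y x hx, ← hmu y' x' hx'] at h1 h2
  have h3 : ∑ i, ((y i - 2 * mu y i) - (y' i - 2 * mu y' i)) ^ 2
      = ∑ i, (y i - y' i) ^ 2 + 4 * (∑ i, (y i - mu y i) * (mu y' i - mu y i)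
        + ∑ i, (y' i - mu y' i) * (mu y i - mu y' i)) := by
    rw [← Finset.sum_add_distrib, Finset.mul_sum, ← Finset.sum_add_distrib]
    refine Finset.sum_congr rfl fun i _ => ?_
    ring
  rw [h3]
  linarith

lemma lasso_zero {N Q P : ℕ} (Φ : Matrix (Fin Q) (Fin N) ℝ) (D : Matrix (Fin N) (Fin P) ℝ)
    (lam : ℝ) (hlam : 0 < lam)
    (mu : (Fin Q → ℝ) → (Fin Q → ℝ))
    (hmu : ∀ y x, IsLassoSol Φ D y lam x → mu y = Φ.mulVec x) : mu 0 = 0 := by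
  have : IsLassoSol Φ D 0 lam 0 := by
    intro x'
    have h0 : lassoObj Φ D 0 lam 0 = 0 := by simp [lassoObj]
    rw [h0]
    unfold lassoObj
    positivity
  rw [hmu 0 0 this, Matrix.mulVec_zero]

/-! ### Spectral norm -/

lemma specNorm_sq {M Q : ℕ} (A : Matrix (Fin M) (Fin Q) ℝ) (v : Fin Q → ℝ) :
    ∑ i, (A.mulVec v i) ^ 2 ≤ specNorm A ^ 2 * ∑ i, v i ^ 2 := by
  have h := (LinearMap.toContinuousLinearMap (Matrix.toEuclideanLin A)).le_opNorm (WithLp.toLp 2 v)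
  have h2 := pow_le_pow_left₀ (norm_nonneg _) h 2
  rw [mul_pow, EuclideanSpace.norm_sq_eq, EuclideanSpace.norm_sq_eq] at h2
  simpa [specNorm, Matrix.toLpLin_apply] using h2

lemma specNorm_transpose {M Q : ℕ} (A : Matrix (Fin M) (Fin Q) ℝ) (z : Fin M → ℝ) :
    ∑ i, (Aᵀ.mulVec z i) ^ 2 ≤ specNorm A ^ 2 * ∑ i, z i ^ 2 := by
  set s := ∑ i, (Aᵀ.mulVec z i) ^ 2 with hs
  have hs0 : 0 ≤ s := Finset.sum_nonneg fun i _ => sq_nonneg _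
  have h1 : s = ∑ i, z i * A.mulVec (Aᵀ.mulVec z) i := by
    have : s = (Aᵀ.mulVec z) ⬝ᵥ (Aᵀ.mulVec z) := by
      simp [hs, dotProduct, sq]
    rw [this]
    nth_rewrite 1 [Matrix.mulVec_transpose]
    rw [← Matrix.dotProduct_mulVec]
    rfl
  have h2 : s ^ 2 ≤ (∑ i, z i ^ 2) * (specNorm A ^ 2 * s) := by
    nth_rewrite 1 [h1]
    refine (Finset.sum_mul_sq_le_sq_mul_sq _ _ _).trans ?_
    exact mul_le_mul_of_nonneg_left (specNorm_sq A _) (Finset.sum_nonneg fun i _ => sq_nonneg _)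
  rcases hs0.eq_or_lt with h | h
  · rw [← h]
    have : 0 ≤ ∑ i, z i ^ 2 := Finset.sum_nonneg fun i _ => sq_nonneg _
    positivity
  · have : s * s ≤ s * (specNorm A ^ 2 * ∑ i, z i ^ 2) := by nlinarith
    exact le_of_mul_le_mul_left this h

lemma specNorm_gram {M Q : ℕ} (A : Matrix (Fin M) (Fin Q) ℝ) (v : Fin Q → ℝ) :
    ∑ i, ((Aᵀ * A).mulVec v i) ^ 2 ≤ specNorm A ^ 4 * ∑ i, v i ^ 2 := by
  rw [← Matrix.mulVec_mulVec]
  refine (specNorm_transpose A _).trans ?_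
  have := mul_le_mul_of_nonneg_left (specNorm_sq A v) (sq_nonneg (specNorm A))
  calc _ ≤ _ := this
    _ = _ := by ring

/-! ### The Gaussian measure -/

instance gaussVec_prob (Q : ℕ) (v : NNReal) : IsProbabilityMeasure (gaussVec Q v) := by
  unfold gaussVec; infer_instance

/-- Density of the Gaussian vector. -/
noncomputable def gdens (Q : ℕ) (v : NNReal) (x : Fin Q → ℝ) : ℝ :=
  ∏ i, gaussianPDFReal 0 v (x i)

lemma gdens_nonneg (Q : ℕ) (v : NNReal) (x : Fin Q → ℝ) : 0 ≤ gdens Q v x :=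
  Finset.prod_nonneg fun _ _ => gaussianPDFReal_nonneg _ _ _

lemma gdens_measurable (Q : ℕ) (v : NNReal) : Measurable (gdens Q v) := by
  unfold gdens
  exact Finset.measurable_prod _ fun i _ =>
    (measurable_gaussianPDFReal 0 v).comp (measurable_pi_apply i)

lemma gaussVec_eq (Q : ℕ) (v : NNReal) (hv : v ≠ 0) :
    gaussVec Q v = (volume : Measure (Fin Q → ℝ)).withDensity
      (fun x => ENNReal.ofReal (gdens Q v x)) := by
  unfold gaussVec
  refine Measure.pi_eq fun s hs => ?_
  rw [withDensity_apply _ (MeasurableSet.univ_pi hs), volume_pi, Measure.restrict_pi_pi]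
  rw [← ofReal_integral_eq_lintegral_ofReal]
  · unfold gdens
    rw [integral_fintype_prod_eq_prod (fun _ => gaussianPDFReal 0 v),
      ENNReal.ofReal_prod_of_nonneg]
    · refine Finset.prod_congr rfl fun i _ => ?_
      rw [gaussianReal_apply_eq_integral 0 hv]
    · intro i _
      exact integral_nonneg fun x => gaussianPDFReal_nonneg _ _ _
  · unfold gdens
    exact Integrable.fintype_prod (f := fun _ => gaussianPDFReal 0 v)
      fun i => (integrable_gaussianPDFReal 0 v).restrict
  · exact Filter.Eventually.of_forall fun x => gdens_nonneg Q v x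

lemma gaussVec_ac (Q : ℕ) (v : NNReal) (hv : v ≠ 0) :
    gaussVec Q v ≪ (volume : Measure (Fin Q → ℝ)) := by
  rw [gaussVec_eq Q v hv]; exact withDensity_absolutelyContinuous _ _

lemma integral_gaussVec (Q : ℕ) (v : NNReal) (hv : v ≠ 0) (F : (Fin Q → ℝ) → ℝ) :
    ∫ x, F x ∂(gaussVec Q v) = ∫ x, gdens Q v x * F x := by
  rw [gaussVec_eq Q v hv, integral_withDensity_eq_integral_toReal_smul
    (gdens_measurable Q v).ennreal_ofReal (by simp)]
  simp [ENNReal.toReal_ofReal (gdens_nonneg Q v _)]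

lemma integrable_gaussVec (Q : ℕ) (v : NNReal) (hv : v ≠ 0) (F : (Fin Q → ℝ) → ℝ) :
    Integrable F (gaussVec Q v) ↔ Integrable (fun x => gdens Q v x * F x) := by
  rw [gaussVec_eq Q v hv, integrable_withDensity_iff_integrable_smul'
    (gdens_measurable Q v).ennreal_ofReal (by simp)]
  simp [ENNReal.toReal_ofReal (gdens_nonneg Q v _)]

lemma gdens_eq (Q : ℕ) (v : NNReal) (x : Fin Q → ℝ) :
    gdens Q v x = ((√(2 * Real.pi * v))⁻¹) ^ Q * Real.exp (-(∑ i, x i ^ 2) / (2 * v)) := by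
  unfold gdens gaussianPDFReal
  rw [Finset.prod_mul_distrib, ← Real.exp_sum]
  simp [neg_div, Finset.sum_div]

/-- Partial derivative. -/
noncomputable def pd {Q : ℕ} (i : Fin Q) (F : (Fin Q → ℝ) → ℝ) (x : Fin Q → ℝ) : ℝ :=
  fderiv ℝ F x (Pi.single i 1)

lemma gdens_hasFDerivAt (Q : ℕ) (v : NNReal) (x : Fin Q → ℝ) :
    HasFDerivAt (gdens Q v) ((gdens Q v x) •
      ((-(2 * (v:ℝ))⁻¹) • ∑ i, (2 * x i) •
        (ContinuousLinearMap.proj i : (Fin Q → ℝ) →L[ℝ] ℝ))) x := by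
  have h0 : gdens Q v = fun x => ((√(2 * Real.pi * v))⁻¹) ^ Q *
      Real.exp (-(2 * (v:ℝ))⁻¹ * (∑ i, x i ^ 2)) := by
    funext x; rw [gdens_eq]; congr 2; ring
  have h1 : HasFDerivAt (fun x : Fin Q → ℝ => ∑ i, x i ^ 2) (∑ i, (2 * x i) •
        (ContinuousLinearMap.proj i : (Fin Q → ℝ) →L[ℝ] ℝ)) x := by
    refine HasFDerivAt.fun_sum fun i _ => ?_
    have := ((ContinuousLinearMap.proj i : (Fin Q → ℝ) →L[ℝ] ℝ).hasFDerivAt (x := x)).pow 2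
    simpa using this
  have h2 := ((h1.const_mul (-(2 * (v:ℝ))⁻¹)).exp).const_mul (((√(2 * Real.pi * v))⁻¹) ^ Q)
  rw [smul_smul] at h2
  rw [h0]
  exact h2

lemma pd_gdens (Q : ℕ) (v : NNReal) (hv : v ≠ 0) (i : Fin Q) (x : Fin Q → ℝ) :
    fderiv ℝ (gdens Q v) x (Pi.single i 1) = -((v:ℝ)⁻¹ * (gdens Q v x * x i)) := by
  rw [(gdens_hasFDerivAt Q v x).fderiv]
  simp [Pi.single_apply]
  ring

lemma stein (Q : ℕ) (v : NNReal) (hv : v ≠ 0) (i : Fin Q) (F : (Fin Q → ℝ) → ℝ)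
    (hF : Differentiable ℝ F) (h1 : Integrable F (gaussVec Q v))
    (h2 : Integrable (fun x => x i * F x) (gaussVec Q v))
    (h3 : Integrable (pd i F) (gaussVec Q v)) :
    ∫ x, x i * F x ∂(gaussVec Q v) = v * ∫ x, pd i F x ∂(gaussVec Q v) := by
  rw [integral_gaussVec Q v hv, integral_gaussVec Q v hv]
  rw [integrable_gaussVec Q v hv] at h1 h2 h3
  have hv' : (v : ℝ) ≠ 0 := by exact_mod_cast hv
  have e : (fun x => fderiv ℝ (gdens Q v) x (Pi.single i 1) * F x)
      = fun x => (-(v:ℝ)⁻¹) * (gdens Q v x * (x i * F x)) := by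
    funext x; rw [pd_gdens Q v hv]; ring
  have := integral_mul_fderiv_eq_neg_fderiv_mul_of_integrable (μ := (volume : Measure (Fin Q → ℝ)))
    (f := gdens Q v) (g := F) (v := Pi.single i 1) (by rw [e]; exact h2.const_mul _) h3 h1
    (fun x _ => (gdens_hasFDerivAt Q v x).differentiableAt) (fun x _ => hF x)
  rw [e, integral_const_mul] at this
  unfold pd
  rw [this]
  field_simp

/-! ### Polynomial growth -/

/-- Continuous functions with polynomial growth. -/
def PG {Q : ℕ} (F : (Fin Q → ℝ) → ℝ) : Prop :=
  Continuous F ∧ ∃ (C : ℝ) (k : ℕ), 0 ≤ C ∧ ∀ x, |F x| ≤ C * (1 + ‖x‖) ^ k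

lemma PG.const {Q : ℕ} (c : ℝ) : PG (fun _ : Fin Q → ℝ => c) :=
  ⟨continuous_const, |c|, 0, abs_nonneg c, fun x => by simp⟩

lemma PG.coord {Q : ℕ} (i : Fin Q) : PG (fun x : Fin Q → ℝ => x i) :=
  ⟨continuous_apply i, 1, 1, zero_le_one, fun x => by
    have := norm_le_pi_norm x i
    rw [Real.norm_eq_abs] at this
    linarith⟩

lemma PG.mul {Q : ℕ} {F G : (Fin Q → ℝ) → ℝ} (hF : PG F) (hG : PG G) :
    PG (fun x => F x * G x) := by
  obtain ⟨cF, C, k, hC, h⟩ := hF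
  obtain ⟨cG, C', k', hC', h'⟩ := hG
  refine ⟨cF.mul cG, C * C', k + k', mul_nonneg hC hC', fun x => ?_⟩
  rw [abs_mul, pow_add]
  calc _ ≤ (C * (1 + ‖x‖) ^ k) * (C' * (1 + ‖x‖) ^ k') :=
        mul_le_mul (h x) (h' x) (abs_nonneg _) (by positivity)
    _ = _ := by ring

lemma PG.add {Q : ℕ} {F G : (Fin Q → ℝ) → ℝ} (hF : PG F) (hG : PG G) :
    PG (fun x => F x + G x) := by
  obtain ⟨cF, C, k, hC, h⟩ := hF
  obtain ⟨cG, C', k', hC', h'⟩ := hG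
  refine ⟨cF.add cG, C + C', k + k', add_nonneg hC hC', fun x => ?_⟩
  have hx : 1 ≤ 1 + ‖x‖ := by linarith [norm_nonneg x]
  have a1 : (1 + ‖x‖) ^ k ≤ (1 + ‖x‖) ^ (k + k') := pow_le_pow_right₀ hx (by omega)
  have a2 : (1 + ‖x‖) ^ k' ≤ (1 + ‖x‖) ^ (k + k') := pow_le_pow_right₀ hx (by omega)
  have := mul_le_mul_of_nonneg_left a1 hC
  have := mul_le_mul_of_nonneg_left a2 hC'
  have := abs_add_le (F x) (G x)
  linarith [h x, h' x]

lemma PG.sub {Q : ℕ} {F G : (Fin Q → ℝ) → ℝ} (hF : PG F) (hG : PG G) :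
    PG (fun x => F x - G x) := by
  have := hF.add ((PG.const (-1)).mul hG)
  simpa [sub_eq_add_neg] using this

lemma PG.sum {Q : ℕ} {ι : Type*} (s : Finset ι) {F : ι → (Fin Q → ℝ) → ℝ} (hF : ∀ i, PG (F i)) :
    PG (fun x => ∑ i ∈ s, F i x) := by
  classical
  induction s using Finset.induction_on with
  | empty => simpa using PG.const 0
  | insert a s ha ih => simpa [Finset.sum_insert ha] using (hF a).add ih

lemma gaussVec_eval (Q : ℕ) (v : NNReal) (i : Fin Q) :
    MeasurePreserving (Function.eval i) (gaussVec Q v) (gaussianReal 0 v) :=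
  measurePreserving_eval (fun _ : Fin Q => gaussianReal 0 v) i

lemma PG.integrable {Q : ℕ} {F : (Fin Q → ℝ) → ℝ} (hF : PG F) (v : NNReal) :
    Integrable F (gaussVec Q v) := by
  obtain ⟨cF, C, k, hC, h⟩ := hF
  have hcoord : ∀ i : Fin Q, MemLp (fun x : Fin Q → ℝ => x i) k (gaussVec Q v) := by
    intro i
    have h1 : MemLp (id : ℝ → ℝ) (k : ENNReal) (gaussianReal 0 v) :=
      memLp_id_gaussianReal' (k : ENNReal) (by simp)
    have h2 := h1.comp_measurePreserving (gaussVec_eval Q v i)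
    have e : (id : ℝ → ℝ) ∘ Function.eval i = fun x : Fin Q → ℝ => x i := rfl
    rw [e] at h2
    exact h2
  have hs1 : MemLp (fun x : Fin Q → ℝ => ∑ i, |x i|) k (gaussVec Q v) :=
    memLp_finsetSum _ fun i _ => (hcoord i).norm
  have hsum : MemLp (fun x : Fin Q → ℝ => 1 + ∑ i, |x i|) k (gaussVec Q v) :=
    (memLp_const (1 : ℝ)).add hs1
  have hI := hsum.integrable_norm_pow'
  refine (hI.const_mul C).mono' cF.aestronglyMeasurable ?_
  refine Filter.Eventually.of_forall fun x => ?_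
  refine (h x).trans ?_
  have hs0 : 0 ≤ ∑ i, |x i| := Finset.sum_nonneg fun i _ => abs_nonneg _
  have hn : ‖x‖ ≤ ∑ i, |x i| := by
    rw [pi_norm_le_iff_of_nonneg hs0]
    intro i
    exact Finset.single_le_sum (f := fun i => |x i|) (fun i _ => abs_nonneg _) (Finset.mem_univ i)
  rw [Real.norm_eq_abs, abs_of_nonneg (by linarith : 0 ≤ 1 + ∑ i, |x i|)]
  gcongr

lemma gauss_mean (Q : ℕ) (v : NNReal) (i : Fin Q) :
    ∫ x, x i ∂(gaussVec Q v) = 0 := by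
  have h2 := integral_map (μ := gaussVec Q v) (φ := Function.eval i) (f := fun x : ℝ => x)
    (gaussVec_eval Q v i).measurable.aemeasurable (by fun_prop)
  rw [(gaussVec_eval Q v i).map_eq, integral_id_gaussianReal] at h2
  exact h2.symm

lemma gauss_sq (Q : ℕ) (v : NNReal) (hv : v ≠ 0) (i : Fin Q) :
    ∫ x, (x i) ^ 2 ∂(gaussVec Q v) = v := by
  have hp : pd i (fun x : Fin Q → ℝ => x i) = fun _ => 1 := by
    funext x
    have := ((ContinuousLinearMap.proj i : (Fin Q → ℝ) →L[ℝ] ℝ).hasFDerivAt (x := x)).fderiv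
    unfold pd
    have e : (fun x : Fin Q → ℝ => x i) = (ContinuousLinearMap.proj i : (Fin Q → ℝ) →L[ℝ] ℝ) := rfl
    rw [e, this]; simp
  have := stein Q v hv i (fun x => x i) (by fun_prop) ((PG.coord i).integrable v)
    (((PG.coord i).mul (PG.coord i)).integrable v) (by rw [hp]; exact (PG.const 1).integrable v)
  rw [hp] at this
  simpa [sq] using this

/-! ### Second moment of the divergence, smooth case -/

lemma pd_mul {Q : ℕ} (i : Fin Q) {F G : (Fin Q → ℝ) → ℝ} (hF : Differentiable ℝ F)
    (hG : Differentiable ℝ G) :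
    pd i (fun x => F x * G x) = fun x => pd i F x * G x + F x * pd i G x := by
  funext x
  unfold pd
  rw [fderiv_fun_mul (hF x) (hG x)]
  simp
  ring

lemma pd_sub {Q : ℕ} (i : Fin Q) {F G : (Fin Q → ℝ) → ℝ} (hF : Differentiable ℝ F)
    (hG : Differentiable ℝ G) :
    pd i (fun x => F x - G x) = fun x => pd i F x - pd i G x := by
  funext x
  unfold pd
  rw [fderiv_fun_sub (hF x) (hG x)]
  simp

lemma pd_const_mul {Q : ℕ} (i : Fin Q) (c : ℝ) {F : (Fin Q → ℝ) → ℝ} (hF : Differentiable ℝ F) :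
    pd i (fun x => c * F x) = fun x => c * pd i F x := by
  funext x
  unfold pd
  rw [fderiv_const_mul (hF x)]
  simp

lemma pd_sum {Q : ℕ} (i : Fin Q) {F : Fin Q → (Fin Q → ℝ) → ℝ} (hF : ∀ j, Differentiable ℝ (F j)) :
    pd i (fun x => ∑ j, F j x) = fun x => ∑ j, pd i (F j) x := by
  funext x
  unfold pd
  rw [fderiv_fun_sum (fun j _ => hF j x)]
  simp

lemma pd_coord {Q : ℕ} (i j : Fin Q) :
    pd i (fun x : Fin Q → ℝ => x j) = fun _ => if j = i then 1 else 0 := by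
  funext x
  have := ((ContinuousLinearMap.proj j : (Fin Q → ℝ) →L[ℝ] ℝ).hasFDerivAt (x := x)).fderiv
  unfold pd
  have e : (fun x : Fin Q → ℝ => x j) = (ContinuousLinearMap.proj j : (Fin Q → ℝ) →L[ℝ] ℝ) := rfl
  rw [e, this]; simp [Pi.single_apply]

lemma pd_comm {Q : ℕ} (i j : Fin Q) {F : (Fin Q → ℝ) → ℝ} (hF : ContDiff ℝ 2 F) :
    pd i (pd j F) = pd j (pd i F) := by
  funext x
  have hd : DifferentiableAt ℝ (fderiv ℝ F) x :=
    ((hF.fderiv_right (m := 1) (by norm_num)).differentiable one_ne_zero) x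
  have hs : IsSymmSndFDerivAt ℝ F x := hF.contDiffAt.isSymmSndFDerivAt (by simp)
  have h : ∀ a b : Fin Q, pd a (pd b F) x
      = fderiv ℝ (fderiv ℝ F) x (Pi.single a 1) (Pi.single b 1) := by
    intro a b
    have : pd b F = fun x => (fderiv ℝ F x) (Pi.single b 1) := rfl
    rw [this]
    unfold pd
    rw [fderiv_clm_apply hd (by fun_prop)]
    simp
  rw [h, h]
  exact hs _ _

lemma pd_contDiff {Q : ℕ} (i : Fin Q) {F : (Fin Q → ℝ) → ℝ} {n : ℕ}
    (hF : ContDiff ℝ ((n + 1 : ℕ) : WithTop ℕ∞) F) : ContDiff ℝ n (pd i F) := by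
  have : ContDiff ℝ n (fderiv ℝ F) := hF.fderiv_right (by push_cast; rfl)
  exact this.clm_apply contDiff_const

/-- The divergence operator (Skorokhod integral). -/
noncomputable def dvg {Q : ℕ} (v : NNReal) (u : Fin Q → (Fin Q → ℝ) → ℝ) (x : Fin Q → ℝ) : ℝ :=
  ∑ i, (x i * u i x - v * pd i (u i) x)

lemma second_moment {Q : ℕ} (v : NNReal) (hv : v ≠ 0) (u : Fin Q → (Fin Q → ℝ) → ℝ)
    (hu : ∀ i, ContDiff ℝ 2 (u i)) (h0 : ∀ i, PG (u i)) (h1 : ∀ i j, PG (pd j (u i)))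
    (h2 : ∀ i j k, PG (pd k (pd j (u i)))) :
    ∫ x, (dvg v u x) ^ 2 ∂(gaussVec Q v)
      = v * ∑ i, ∫ x, u i x ^ 2 ∂(gaussVec Q v)
        + (v : ℝ) ^ 2 * ∑ i, ∑ j, ∫ x, pd j (u i) x * pd i (u j) x ∂(gaussVec Q v) := by
  set γ := gaussVec Q v with hγ
  have d0 : ∀ i, Differentiable ℝ (u i) := fun i => (hu i).differentiable (by norm_num)
  have d1 : ∀ i j, Differentiable ℝ (pd j (u i)) := fun i j =>
    (pd_contDiff (n := 1) j (by exact_mod_cast hu i)).differentiable (by norm_num)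
  have dterm : ∀ i, Differentiable ℝ (fun x : Fin Q → ℝ => x i * u i x - v * pd i (u i) x) :=
    fun i => by
      have := d0 i
      have := d1 i i
      fun_prop
  have dδ : Differentiable ℝ (dvg v u) := by
    unfold dvg
    exact Differentiable.fun_sum fun i _ => dterm i
  have pδ : PG (dvg v u) :=
    PG.sum _ fun i => ((PG.coord i).mul (h0 i)).sub ((PG.const (v:ℝ)).mul (h1 i i))
  have eδ : ∀ i, pd i (dvg v u) = fun x => u i x + ∑ j, (x j * pd i (u j) x
      - v * pd j (pd i (u j)) x) := by
    intro i
    have : dvg v u = fun x => ∑ j, (x j * u j x - v * pd j (u j) x) := rfl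
    rw [this, pd_sum i dterm]
    funext x
    have e : ∀ j, pd i (fun x : Fin Q → ℝ => x j * u j x - v * pd j (u j) x) x
        = (if j = i then 1 else 0) * u j x + (x j * pd i (u j) x - v * pd j (pd i (u j)) x) := by
      intro j
      rw [pd_sub i ((by fun_prop : Differentiable ℝ fun x : Fin Q → ℝ => x j).fun_mul (d0 j))
        ((d1 j j).const_mul _), pd_mul i (by fun_prop) (d0 j), pd_const_mul i _ (d1 j j), pd_coord,
        pd_comm i j (hu j)]
      ring
    simp only [e, Finset.sum_add_distrib]
    simp
  have pdδ : ∀ i, PG (pd i (dvg v u)) := by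
    intro i
    rw [eδ i]
    exact (h0 i).add (PG.sum _ fun j => ((PG.coord j).mul (h1 j i)).sub
      ((PG.const (v:ℝ)).mul (h2 j i j)))
  -- first integration by parts
  have s1 : ∀ i, ∫ x, x i * (u i x * dvg v u x) ∂γ
      = v * (∫ x, pd i (u i) x * dvg v u x ∂γ + ∫ x, u i x * pd i (dvg v u) x ∂γ) := by
    intro i
    have hp := pd_mul i (d0 i) dδ
    rw [stein Q v hv i (fun x => u i x * dvg v u x) ((d0 i).mul dδ)
      (((h0 i).mul pδ).integrable v) (((PG.coord i).mul ((h0 i).mul pδ)).integrable v)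
      (by rw [hp]; exact (((h1 i i).mul pδ).add ((h0 i).mul (pdδ i))).integrable v), hp,
      integral_add (((h1 i i).mul pδ).integrable v) (((h0 i).mul (pdδ i)).integrable v)]
  have t1 : ∫ x, (dvg v u x) ^ 2 ∂γ = v * ∑ i, ∫ x, u i x * pd i (dvg v u) x ∂γ := by
    have e : (fun x => (dvg v u x) ^ 2) = fun x => ∑ i, (x i * (u i x * dvg v u x)
        - v * (pd i (u i) x * dvg v u x)) := by
      funext x
      rw [sq]
      nth_rewrite 1 [dvg]
      rw [Finset.sum_mul]
      refine Finset.sum_congr rfl fun i _ => ?_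
      ring
    rw [e, integral_finsetSum _ fun i _ => (((PG.coord i).mul ((h0 i).mul pδ)).sub
      ((PG.const (v:ℝ)).mul ((h1 i i).mul pδ))).integrable v, Finset.mul_sum]
    refine Finset.sum_congr rfl fun i _ => ?_
    rw [integral_sub (((PG.coord i).mul ((h0 i).mul pδ)).integrable v)
      (((PG.const (v:ℝ)).mul ((h1 i i).mul pδ)).integrable v), s1 i, integral_const_mul]
    ring
  -- second integration by parts
  have s2 : ∀ i j, ∫ x, x j * (u i x * pd i (u j) x) ∂γ
      = v * (∫ x, pd j (u i) x * pd i (u j) x ∂γ + ∫ x, u i x * pd j (pd i (u j)) x ∂γ) := by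
    intro i j
    have hp := pd_mul j (d0 i) (d1 j i)
    rw [stein Q v hv j (fun x => u i x * pd i (u j) x) ((d0 i).mul (d1 j i))
      (((h0 i).mul (h1 j i)).integrable v) (((PG.coord j).mul ((h0 i).mul (h1 j i))).integrable v)
      (by rw [hp]; exact (((h1 i j).mul (h1 j i)).add ((h0 i).mul (h2 j i j))).integrable v), hp,
      integral_add (((h1 i j).mul (h1 j i)).integrable v) (((h0 i).mul (h2 j i j)).integrable v)]
  have t2 : ∀ i, ∫ x, u i x * pd i (dvg v u) x ∂γ
      = ∫ x, u i x ^ 2 ∂γ + v * ∑ j, ∫ x, pd j (u i) x * pd i (u j) x ∂γ := by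
    intro i
    have e : (fun x => u i x * pd i (dvg v u) x) = fun x => u i x ^ 2
        + ∑ j, (x j * (u i x * pd i (u j) x) - v * (u i x * pd j (pd i (u j)) x)) := by
      funext x
      rw [eδ i]
      simp only [mul_add, Finset.mul_sum]
      congr 1
      · ring
      · refine Finset.sum_congr rfl fun j _ => ?_
        ring
    have hterm : ∀ j, PG (fun x : Fin Q → ℝ => x j * (u i x * pd i (u j) x)
        - v * (u i x * pd j (pd i (u j)) x)) := fun j =>
      ((PG.coord j).mul ((h0 i).mul (h1 j i))).sub
        ((PG.const (v:ℝ)).mul ((h0 i).mul (h2 j i j)))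
    have hsq : PG (fun x => u i x ^ 2) := by simpa [sq] using (h0 i).mul (h0 i)
    rw [e, integral_add (hsq.integrable v) ((PG.sum _ hterm).integrable v),
      integral_finsetSum _ fun j _ => (hterm j).integrable v, Finset.mul_sum]
    congr 1
    refine Finset.sum_congr rfl fun j _ => ?_
    rw [integral_sub (((PG.coord j).mul ((h0 i).mul (h1 j i))).integrable v)
      (((PG.const (v:ℝ)).mul ((h0 i).mul (h2 j i j))).integrable v), s2 i j, integral_const_mul]
    ring
  rw [t1]
  simp only [t2, Finset.sum_add_distrib, ← Finset.mul_sum]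
  ring

/-! ### Mollification -/

/-- Scalar convolution. -/
noncomputable def cv {Q : ℕ} (ψ f : (Fin Q → ℝ) → ℝ) : (Fin Q → ℝ) → ℝ :=
  MeasureTheory.convolution ψ f (ContinuousLinearMap.lsmul ℝ ℝ) volume

lemma cv_apply {Q : ℕ} (ψ f : (Fin Q → ℝ) → ℝ) (x : Fin Q → ℝ) :
    cv ψ f x = ∫ t, ψ t * f (x - t) := rfl

lemma cv_integrable {Q : ℕ} {ψ f : (Fin Q → ℝ) → ℝ} (hψ : Continuous ψ)
    (hc : HasCompactSupport ψ) (hf : Continuous f) : Integrable (fun t => ψ t * f t) :=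
  (hψ.mul hf).integrable_of_hasCompactSupport hc.mul_right

lemma cv_contDiff {Q : ℕ} {ψ f : (Fin Q → ℝ) → ℝ} {n : ℕ} (hψ : ContDiff ℝ n ψ)
    (hc : HasCompactSupport ψ) (hf : Continuous f) : ContDiff ℝ n (cv ψ f) := by
  have := hc.contDiff_convolution_left (n := (n : ℕ∞)) (μ := (volume : Measure (Fin Q → ℝ)))
    (ContinuousLinearMap.lsmul ℝ ℝ) (by exact_mod_cast hψ) hf.locallyIntegrable
  exact_mod_cast this

lemma pd_compact {Q : ℕ} {ψ : (Fin Q → ℝ) → ℝ} (j : Fin Q) (hc : HasCompactSupport ψ) :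
    HasCompactSupport (pd j ψ) := hc.fderiv_apply ℝ _

lemma pd_cv {Q : ℕ} {ψ f : (Fin Q → ℝ) → ℝ} (j : Fin Q) (hψ : ContDiff ℝ 1 ψ)
    (hc : HasCompactSupport ψ) (hf : Continuous f) : pd j (cv ψ f) = cv (pd j ψ) f := by
  funext x
  have h := hc.hasFDerivAt_convolution_right (μ := (volume : Measure (Fin Q → ℝ)))
    (ContinuousLinearMap.lsmul ℝ ℝ).flip (f := f) hf.locallyIntegrable hψ x
  rw [convolution_flip] at h
  unfold pd cv
  rw [h.fderiv, convolution_precompR_apply _ hf.locallyIntegrable (hc.fderiv ℝ)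
    (hψ.continuous_fderiv one_ne_zero), convolution_flip]

lemma cv_PG {Q : ℕ} {ψ f : (Fin Q → ℝ) → ℝ} {K : NNReal} (hψ : Continuous ψ)
    (hc : HasCompactSupport ψ) (hf : LipschitzWith K f) : PG (cv ψ f) := by
  have hi : ∀ x, Integrable (fun t => ψ t * f (x - t)) := fun x =>
    cv_integrable hψ hc (hf.continuous.comp (by fun_prop))
  have hψi : Integrable (fun t => |ψ t|) := (hψ.integrable_of_hasCompactSupport hc).abs
  have hI : 0 ≤ ∫ t, |ψ t| := integral_nonneg fun _ => abs_nonneg _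
  have hd : ∀ x, |cv ψ f x - cv ψ f 0| ≤ (∫ t, |ψ t|) * (K * ‖x‖) := by
    intro x
    rw [cv_apply, cv_apply, ← integral_sub (hi x) (hi 0), ← integral_mul_const,
      ← Real.norm_eq_abs]
    refine (norm_integral_le_integral_norm _).trans ?_
    refine integral_mono_of_nonneg (Filter.Eventually.of_forall fun _ => norm_nonneg _)
      (hψi.mul_const _) (Filter.Eventually.of_forall fun t => ?_)
    simp only
    rw [← mul_sub, norm_mul, Real.norm_eq_abs]
    refine mul_le_mul_of_nonneg_left ?_ (abs_nonneg _)
    have := hf.norm_sub_le (x - t) (0 - t)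
    simpa using this
  refine ⟨?_, |cv ψ f 0| + (∫ t, |ψ t|) * K, 1, by positivity, fun x => ?_⟩
  · have h00 : ContDiff ℝ ((0 : ℕ) : WithTop ℕ∞) ψ := by
      exact_mod_cast (contDiff_zero.2 hψ : ContDiff ℝ 0 ψ)
    have h01 : ContDiff ℝ ((0 : ℕ) : WithTop ℕ∞) (cv ψ f) :=
      cv_contDiff (n := 0) h00 hc hf.continuous
    exact h01.continuous
  · have h1 := hd x
    have h2 : |cv ψ f x| ≤ |cv ψ f x - cv ψ f 0| + |cv ψ f 0| := by
      have := abs_add_le (cv ψ f x - cv ψ f 0) (cv ψ f 0)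
      simpa using this
    have h3 : 0 ≤ |cv ψ f 0| * ‖x‖ := by positivity
    have h4 : 0 ≤ (∫ t, |ψ t|) * K := by positivity
    nlinarith

lemma pd_cv_lineDeriv {Q : ℕ} {ψ f : (Fin Q → ℝ) → ℝ} {K : NNReal} (j : Fin Q)
    (hψ : ContDiff ℝ 1 ψ) (hc : HasCompactSupport ψ) (hf : LipschitzWith K f) :
    pd j (cv ψ f) = cv ψ (fun x => lineDeriv ℝ f x (Pi.single j 1)) := by
  rw [pd_cv j hψ hc hf.continuous]
  funext x
  rw [cv_apply, cv_apply]
  obtain ⟨D, hD⟩ := ContDiff.lipschitzWith_of_hasCompactSupport hc hψ one_ne_zero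
  have hf' : LipschitzWith K (fun t => f (x - t)) := by
    have := hf.comp (LipschitzWith.of_dist_le_mul (K := 1) (f := fun t : Fin Q → ℝ => x - t)
      (fun a b => by
        simp only [NNReal.coe_one, one_mul, dist_eq_norm]
        rw [sub_sub_sub_cancel_left, norm_sub_rev]))
    simpa [Function.comp_def] using this
  have h := hf'.integral_lineDeriv_mul_eq (μ := (volume : Measure (Fin Q → ℝ))) hD hc
    (-Pi.single j 1)
  have e1 : ∀ t, lineDeriv ℝ (fun t => f (x - t)) t (-Pi.single j 1)
      = lineDeriv ℝ f (x - t) (Pi.single j 1) := by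
    intro t
    unfold lineDeriv
    have e : (fun s : ℝ => f (x - (t + s • -(Pi.single j 1 : Fin Q → ℝ))))
        = fun s : ℝ => f (x - t + s • (Pi.single j 1 : Fin Q → ℝ)) := by
      funext s
      rw [smul_neg]
      congr 1
      abel
    rw [e]
  have e2 : ∀ t, lineDeriv ℝ ψ t (- -Pi.single j 1) = pd j ψ t := by
    intro t
    rw [neg_neg, ((hψ.differentiable one_ne_zero) t).lineDeriv_eq_fderiv]
    rfl
  simp only [e1, e2] at h
  rw [← h]
  refine integral_congr_ae (Filter.Eventually.of_forall fun t => ?_)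
  simp only
  ring

lemma jensen_sq {Q : ℕ} {φ : (Fin Q → ℝ) → ℝ} (hφ : ∀ t, 0 ≤ φ t) (hφi : Integrable φ)
    (h1 : ∫ t, φ t = 1)
    (a : Fin Q → (Fin Q → ℝ) → ℝ) (ha : ∀ i, Integrable (fun t => φ t * a i t)) (c : ℝ)
    (hc : ∀ t, φ t ≠ 0 → ∑ i, a i t ^ 2 ≤ c) :
    ∑ i, (∫ t, φ t * a i t) ^ 2 ≤ c := by
  set d : Fin Q → ℝ := fun i => ∫ t, φ t * a i t with hd
  have e1 : ∑ i, 2 * d i * d i = ∫ t, ∑ i, 2 * d i * (φ t * a i t) := by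
    rw [integral_finsetSum _ fun i _ => (ha i).const_mul _]
    refine Finset.sum_congr rfl fun i _ => ?_
    rw [integral_const_mul]
  have e2 : ∫ t, ∑ i, 2 * d i * (φ t * a i t) ≤ ∫ t, φ t * (∑ i, d i ^ 2 + c) := by
    refine integral_mono (integrable_finsetSum _ fun i _ => (ha i).const_mul _)
      (hφi.mul_const _) fun t => ?_
    by_cases h0 : φ t = 0
    · simp [h0]
    · have hct := hc t h0
      have : ∑ i, 2 * d i * (φ t * a i t) = φ t * ∑ i, 2 * d i * a i t := by
        rw [Finset.mul_sum]; exact Finset.sum_congr rfl fun i _ => by ring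
      simp only
      rw [this]
      refine mul_le_mul_of_nonneg_left ?_ (hφ t)
      have : ∑ i, 2 * d i * a i t ≤ ∑ i, d i ^ 2 + ∑ i, a i t ^ 2 := by
        rw [← Finset.sum_add_distrib]
        exact Finset.sum_le_sum fun i _ => by nlinarith [sq_nonneg (d i - a i t)]
      linarith
  rw [integral_mul_const, h1, ← e1] at e2
  have e3 : ∑ i, 2 * d i * d i = 2 * ∑ i, d i ^ 2 := by
    rw [Finset.mul_sum]; exact Finset.sum_congr rfl fun i _ => by ring
  linarith

lemma pd_sq_bound {Q : ℕ} (g : Fin Q → (Fin Q → ℝ) → ℝ) (hg : ∀ i, Differentiable ℝ (g i))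
    (L : ℝ) (x : Fin Q → ℝ) (j : Fin Q)
    (h : ∀ y, ∑ i, (g i y - g i x) ^ 2 ≤ L * ∑ i, (y i - x i) ^ 2) :
    ∑ i, (pd j (g i) x) ^ 2 ≤ L := by
  have hl : ∀ i, Filter.Tendsto (fun t : ℝ => t⁻¹ • (g i (x + t • Pi.single j 1) - g i x))
      (nhdsWithin 0 {0}ᶜ) (nhds (pd j (g i) x)) := by
    intro i
    have h1 := ((hg i x).hasFDerivAt.hasLineDerivAt (Pi.single j 1)).tendsto_slope_zero
    exact h1
  have hs : Filter.Tendsto (fun t : ℝ =>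
      ∑ i, (t⁻¹ • (g i (x + t • Pi.single j 1) - g i x)) ^ 2)
      (nhdsWithin 0 {0}ᶜ) (nhds (∑ i, (pd j (g i) x) ^ 2)) :=
    tendsto_finsetSum _ fun i _ => (hl i).pow 2
  refine le_of_tendsto hs ?_
  filter_upwards [self_mem_nhdsWithin] with t ht
  have ht : t ≠ 0 := ht
  have h1 := h (x + t • Pi.single j 1)
  have h2 : ∑ i, ((x + t • (Pi.single j 1 : Fin Q → ℝ)) i - x i) ^ 2 = t ^ 2 := by
    simp [Pi.single_apply, ite_pow, mul_ite]
  rw [h2] at h1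
  have h3 : ∑ i, (t⁻¹ • (g i (x + t • Pi.single j 1) - g i x)) ^ 2
      = (t⁻¹) ^ 2 * ∑ i, (g i (x + t • Pi.single j 1) - g i x) ^ 2 := by
    rw [Finset.mul_sum]
    exact Finset.sum_congr rfl fun i _ => by rw [smul_eq_mul]; ring
  rw [h3]
  calc _ ≤ (t⁻¹) ^ 2 * (L * t ^ 2) := mul_le_mul_of_nonneg_left h1 (sq_nonneg _)
    _ = L := by field_simp

lemma fatou_bound {α : Type*} [MeasurableSpace α] {μ : Measure α} (f : ℕ → α → ℝ) (g : α → ℝ)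
    (C : ℝ) (hC : 0 ≤ C) (hf : ∀ n, Integrable (f n) μ) (h0 : ∀ n x, 0 ≤ f n x)
    (hb : ∀ n, ∫ x, f n x ∂μ ≤ C)
    (ht : ∀ᵐ x ∂μ, Filter.Tendsto (fun n => f n x) Filter.atTop (nhds (g x))) :
    ∫ x, g x ∂μ ≤ C := by
  have hg0 : 0 ≤ᵐ[μ] g := by
    filter_upwards [ht] with x hx
    exact ge_of_tendsto hx (Filter.Eventually.of_forall fun n => h0 n x)
  have hgm : AEStronglyMeasurable g μ :=
    aestronglyMeasurable_of_tendsto_ae Filter.atTop (fun n => (hf n).aestronglyMeasurable) ht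
  rw [integral_eq_lintegral_of_nonneg_ae hg0 hgm]
  refine ENNReal.toReal_le_of_le_ofReal hC ?_
  have e : ∫⁻ x, ENNReal.ofReal (g x) ∂μ
      = ∫⁻ x, Filter.liminf (fun n => ENNReal.ofReal (f n x)) Filter.atTop ∂μ := by
    refine lintegral_congr_ae ?_
    filter_upwards [ht] with x hx
    exact ((ENNReal.continuous_ofReal.tendsto _).comp hx).liminf_eq.symm
  rw [e]
  refine (lintegral_liminf_le' fun n => (hf n).aestronglyMeasurable.aemeasurable.ennreal_ofReal).trans ?_
  refine Filter.liminf_le_of_le (by isBoundedDefault) fun b hbb => ?_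
  obtain ⟨n, hn⟩ := hbb.exists
  refine hn.trans ?_
  rw [← ofReal_integral_eq_lintegral_ofReal (hf n) (Filter.Eventually.of_forall (h0 n))]
  exact ENNReal.ofReal_le_ofReal (hb n)

/-! ### Second moment bound, Lipschitz case -/

lemma dvg_bound {Q : ℕ} (v : NNReal) (hv : v ≠ 0) (u : Fin Q → (Fin Q → ℝ) → ℝ) (K : NNReal)
    (hlip : ∀ i, LipschitzWith K (u i)) (L : ℝ) (hL0 : 0 ≤ L) (m : Fin Q → ℝ)
    (hL : ∀ x y, ∑ i, (u i x - u i y) ^ 2 ≤ L * ∑ i, (x i - y i) ^ 2)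
    (hG : ∀ x, ∑ i, u i x ^ 2 ≤ L * (2 * ∑ i, (m i + x i) ^ 2 + 2 * ∑ i, m i ^ 2)) :
    ∫ x, (dvg v u x) ^ 2 ∂(gaussVec Q v)
      ≤ L * (9 * Q * (v:ℝ) ^ 2 + 6 * v * ∑ i, m i ^ 2) := by
  set S := ∑ i, m i ^ 2 with hS
  have hS0 : 0 ≤ S := Finset.sum_nonneg fun i _ => sq_nonneg _
  have hvp : 0 < (v : ℝ) := by exact_mod_cast pos_iff_ne_zero.2 hv
  have hsv : 0 < √(v : ℝ) := Real.sqrt_pos.2 hvp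
  let r : ℕ → ℝ := fun n => √(v : ℝ) / (n + 1)
  have hr : ∀ n, 0 < r n := fun n => by positivity
  have hr2 : ∀ n, (r n) ^ 2 ≤ v := fun n => by
    have h1 : r n ≤ √(v : ℝ) := div_le_self hsv.le (by linarith [n.cast_nonneg (α := ℝ)])
    calc (r n) ^ 2 ≤ √(v : ℝ) ^ 2 := pow_le_pow_left₀ (hr n).le h1 2
      _ = v := Real.sq_sqrt hvp.le
  let ρ : ℕ → ContDiffBump (0 : Fin Q → ℝ) := fun n =>
    { rIn := r n / 2, rOut := r n, rIn_pos := half_pos (hr n), rIn_lt_rOut := half_lt_self (hr n) }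
  have hr0 : Filter.Tendsto r Filter.atTop (nhds 0) := by
    have := (tendsto_one_div_add_atTop_nhds_zero_nat (𝕜 := ℝ)).const_mul (√(v:ℝ))
    simpa [r, div_eq_mul_inv] using this
  have hρ0 : Filter.Tendsto (fun n => (ρ n).rOut) Filter.atTop (nhds 0) := hr0
  let φ : ℕ → (Fin Q → ℝ) → ℝ := fun n => (ρ n).normed volume
  have φc : ∀ n, HasCompactSupport (φ n) := fun n => (ρ n).hasCompactSupport_normed
  have φs : ∀ n (k : ℕ), ContDiff ℝ k (φ n) := fun n k => by
    have : ContDiff ℝ ((k : ℕ∞) : WithTop ℕ∞) (φ n) := (ρ n).contDiff_normed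
    exact_mod_cast this
  have φcont : ∀ n, Continuous (φ n) := fun n => (φs n 0).continuous
  have φn : ∀ n t, 0 ≤ φ n t := fun n t => (ρ n).nonneg_normed t
  have φi : ∀ n, Integrable (φ n) := fun n => (ρ n).integrable_normed
  have φ1 : ∀ n, ∫ t, φ n t = 1 := fun n => (ρ n).integral_normed
  have φsupp : ∀ n t, φ n t ≠ 0 → ‖t‖ < r n := by
    intro n t ht
    have : t ∈ Function.support ((ρ n).normed volume) := ht
    rw [ContDiffBump.support_normed_eq] at this
    simpa using this
  have uc : ∀ i, Continuous (u i) := fun i => (hlip i).continuous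
  let U : ℕ → Fin Q → (Fin Q → ℝ) → ℝ := fun n i => cv (φ n) (u i)
  have U0 : ∀ n i, PG (U n i) := fun n i => cv_PG (φcont n) (φc n) (hlip i)
  have U1e : ∀ n i j, pd j (U n i) = cv (pd j (φ n)) (u i) := fun n i j =>
    pd_cv j (by exact_mod_cast φs n 1) (φc n) (uc i)
  have pφs : ∀ n j, ContDiff ℝ 1 (pd j (φ n)) := fun n j => by
    exact_mod_cast pd_contDiff (n := 1) j (φs n 2)
  have ppφs : ∀ n j k, Continuous (pd k (pd j (φ n))) := fun n j k =>
    (pd_contDiff (n := 0) k (by exact_mod_cast pφs n j)).continuous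
  have U1 : ∀ n i j, PG (pd j (U n i)) := fun n i j => by
    rw [U1e]; exact cv_PG (pφs n j).continuous (pd_compact j (φc n)) (hlip i)
  have U2 : ∀ n i j k, PG (pd k (pd j (U n i))) := fun n i j k => by
    rw [U1e, pd_cv k (pφs n j) (pd_compact j (φc n)) (uc i)]
    exact cv_PG (ppφs n j k) (pd_compact k (pd_compact j (φc n))) (hlip i)
  have Us : ∀ n i, ContDiff ℝ 2 (U n i) := fun n i => by
    exact_mod_cast cv_contDiff (φs n 2) (φc n) (uc i)
  have Ui : ∀ n i x, Integrable (fun t => φ n t * u i (x - t)) := fun n i x =>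
    cv_integrable (φcont n) (φc n) ((uc i).comp (by fun_prop))
  -- Lipschitz bound for the mollification
  have ULip : ∀ n x y, ∑ i, (U n i y - U n i x) ^ 2 ≤ L * ∑ i, (y i - x i) ^ 2 := by
    intro n x y
    have e : ∀ i, U n i y - U n i x = ∫ t, φ n t * (u i (y - t) - u i (x - t)) := by
      intro i
      simp only [U, cv_apply, mul_sub]
      rw [integral_sub (Ui n i y) (Ui n i x)]
    simp only [e]
    refine jensen_sq (φn n) (φi n) (φ1 n) (fun i t => u i (y - t) - u i (x - t)) (fun i => ?_) _
      fun t _ => ?_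
    · simp only [mul_sub]
      exact (Ui n i y).sub (Ui n i x)
    · have := hL (y - t) (x - t)
      simpa using this
  have UJ : ∀ n x j, ∑ i, (pd j (U n i) x) ^ 2 ≤ L := fun n x j =>
    pd_sq_bound (U n) (fun i => (Us n i).differentiable (by norm_num)) L x j (ULip n x)
  have UG : ∀ n x, ∑ i, U n i x ^ 2
      ≤ L * (4 * ∑ i, (m i + x i) ^ 2 + 4 * Q * v + 2 * S) := by
    intro n x
    simp only [U, cv_apply]
    refine jensen_sq (φn n) (φi n) (φ1 n) (fun i t => u i (x - t)) (fun i => Ui n i x) _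
      fun t ht => ?_
    refine (hG (x - t)).trans (mul_le_mul_of_nonneg_left ?_ hL0)
    have h1 : ∑ i, (m i + (x - t) i) ^ 2 ≤ 2 * ∑ i, (m i + x i) ^ 2 + 2 * (Q * v) := by
      have : (2 * (Q * v) : ℝ) = ∑ i : Fin Q, 2 * (v : ℝ) := by simp; ring
      rw [this, Finset.mul_sum, ← Finset.sum_add_distrib]
      refine Finset.sum_le_sum fun i _ => ?_
      have h2 : |t i| ≤ r n := (norm_le_pi_norm t i).trans (φsupp n t ht).le
      have h3 : (t i) ^ 2 ≤ v := by
        refine le_trans ?_ (hr2 n)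
        rw [← sq_abs]
        exact pow_le_pow_left₀ (abs_nonneg _) h2 2
      simp only [Pi.sub_apply]
      nlinarith [sq_nonneg (m i + x i + t i)]
    linarith
  -- the bound for the mollified field
  have hsq : ∀ n i, PG (fun x => U n i x ^ 2) := fun n i => by
    simpa [sq] using (U0 n i).mul (U0 n i)
  have hmx : ∀ i, PG (fun x : Fin Q → ℝ => (m i + x i) ^ 2) := fun i => by
    simpa [sq] using ((PG.const (m i)).add (PG.coord i)).mul ((PG.const (m i)).add (PG.coord i))
  have hmint : ∀ i, ∫ x : Fin Q → ℝ, (m i + x i) ^ 2 ∂(gaussVec Q v) = m i ^ 2 + v := by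
    intro i
    have hx2 : PG (fun x : Fin Q → ℝ => (x i) ^ 2) := by
      simpa [sq] using (PG.coord i).mul (PG.coord i)
    have e : (fun x : Fin Q → ℝ => (m i + x i) ^ 2)
        = fun x => (m i ^ 2 + (2 * m i) * x i) + (x i) ^ 2 := by funext x; ring
    rw [e, integral_add (((PG.const _).add ((PG.const _).mul (PG.coord i))).integrable v)
      (hx2.integrable v), integral_add ((PG.const _).integrable v)
      (((PG.const _).mul (PG.coord i)).integrable v), integral_const_mul, gauss_mean,
      gauss_sq Q v hv]
    simp
  have B1 : ∀ n, ∑ i, ∫ x, U n i x ^ 2 ∂(gaussVec Q v) ≤ L * (6 * S + 8 * Q * v) := by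
    intro n
    rw [← integral_finsetSum _ fun i _ => (hsq n i).integrable v]
    have hpg : PG (fun x : Fin Q → ℝ => L * (4 * ∑ i, (m i + x i) ^ 2 + 4 * Q * v + 2 * S)) :=
      (PG.const L).mul ((((PG.const 4).mul (PG.sum _ hmx)).add (PG.const _)).add (PG.const _))
    refine (integral_mono ((PG.sum _ (hsq n)).integrable v) (hpg.integrable v) (UG n)).trans ?_
    rw [integral_const_mul, integral_add ((((PG.const 4).mul (PG.sum _ hmx)).add
      (PG.const _)).integrable v) ((PG.const _).integrable v),
      integral_add (((PG.const 4).mul (PG.sum _ hmx)).integrable v) ((PG.const _).integrable v),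
      integral_const_mul, integral_finsetSum _ fun i _ => (hmx i).integrable v]
    simp only [hmint, Finset.sum_add_distrib]
    refine le_of_eq ?_
    simp only [← hS, integral_const, probReal_univ, Finset.sum_const, Finset.card_univ,
      Fintype.card_fin, nsmul_eq_mul, smul_eq_mul]
    ring
  have B2 : ∀ n, ∑ i, ∑ j, ∫ x, pd j (U n i) x * pd i (U n j) x ∂(gaussVec Q v) ≤ Q * L := by
    intro n
    have hterm : ∀ i j, PG (fun x => pd j (U n i) x * pd i (U n j) x) := fun i j =>
      (U1 n i j).mul (U1 n j i)
    have e : ∑ i, ∑ j, ∫ x, pd j (U n i) x * pd i (U n j) x ∂(gaussVec Q v)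
        = ∫ x, ∑ i, ∑ j, pd j (U n i) x * pd i (U n j) x ∂(gaussVec Q v) := by
      rw [integral_finsetSum _ fun i _ => (PG.sum _ (hterm i)).integrable v]
      refine Finset.sum_congr rfl fun i _ => ?_
      rw [integral_finsetSum _ fun j _ => (hterm i j).integrable v]
    rw [e]
    have hle : ∀ x, ∑ i, ∑ j, pd j (U n i) x * pd i (U n j) x ≤ Q * L := by
      intro x
      have h1 : ∑ i, ∑ j, pd j (U n i) x * pd i (U n j) x
          ≤ ∑ i, ∑ j, ((pd j (U n i) x) ^ 2 / 2 + (pd i (U n j) x) ^ 2 / 2) :=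
        Finset.sum_le_sum fun i _ => Finset.sum_le_sum fun j _ => by
          nlinarith [sq_nonneg (pd j (U n i) x - pd i (U n j) x)]
      have h2 : ∑ j, ∑ i, (pd j (U n i) x) ^ 2 ≤ Q * L := by
        calc _ ≤ ∑ _j : Fin Q, L := Finset.sum_le_sum fun j _ => UJ n x j
          _ = Q * L := by simp
      have h3 : ∑ i, ∑ j, (pd j (U n i) x) ^ 2 = ∑ j, ∑ i, (pd j (U n i) x) ^ 2 :=
        Finset.sum_comm
      refine h1.trans ?_
      simp only [Finset.sum_add_distrib, ← Finset.sum_div]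
      linarith
    refine (integral_mono ((PG.sum _ fun i => PG.sum _ (hterm i)).integrable v)
      ((PG.const (Q * L)).integrable v) hle).trans ?_
    simp
  have dPG : ∀ n, PG (dvg v (U n)) := fun n =>
    PG.sum _ fun i => ((PG.coord i).mul (U0 n i)).sub ((PG.const (v:ℝ)).mul (U1 n i i))
  refine fatou_bound (fun n x => (dvg v (U n) x) ^ 2) _ _ (by positivity) (fun n => ?_)
    (fun n x => sq_nonneg _) (fun n => ?_) ?_
  · have := ((dPG n).mul (dPG n)).integrable v
    simpa [sq] using this
  · rw [second_moment v hv (U n) (Us n) (U0 n) (U1 n) (U2 n)]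
    have h1 := mul_le_mul_of_nonneg_left (B1 n) hvp.le
    have h2 := mul_le_mul_of_nonneg_left (B2 n) (sq_nonneg (v : ℝ))
    linarith
  · -- almost everywhere convergence
    have hlim : ∀ i, ∀ᵐ x ∂(volume : Measure (Fin Q → ℝ)),
        Filter.Tendsto (fun n => pd i (U n i) x) Filter.atTop (nhds (pd i (u i) x)) := by
      intro i
      have hli : LocallyIntegrable (fun x => lineDeriv ℝ (u i) x (Pi.single i 1))
          (volume : Measure (Fin Q → ℝ)) := by
        have hmeas := (measurable_lineDeriv (𝕜 := ℝ) (v := (Pi.single i 1 : Fin Q → ℝ)) (uc i))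
        refine (locallyIntegrable_const (K * ‖(Pi.single i 1 : Fin Q → ℝ)‖ : ℝ)).mono
          hmeas.aestronglyMeasurable (Filter.Eventually.of_forall fun x => ?_)
        refine (norm_lineDeriv_le_of_lipschitz ℝ (hlip i)).trans (le_abs_self _)
      have h1 := ContDiffBump.ae_convolution_tendsto_right_of_locallyIntegrable (φ := ρ)
        (l := Filter.atTop) (K := 2) hρ0
        (Filter.Eventually.of_forall fun n => by simp only [ρ]; linarith) hli
      filter_upwards [h1, (hlip i).ae_differentiableAt] with x hx hdx
      have e : ∀ n, pd i (U n i) x = cv (φ n) (fun x => lineDeriv ℝ (u i) x (Pi.single i 1)) x := by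
        intro n
        have := pd_cv_lineDeriv i (by exact_mod_cast φs n 1) (φc n) (hlip i)
        exact congrFun this x
      simp only [e]
      rw [hdx.lineDeriv_eq_fderiv] at hx
      exact hx
    have hlim0 : ∀ i x, Filter.Tendsto (fun n => U n i x) Filter.atTop (nhds (u i x)) :=
      fun i x => ContDiffBump.convolution_tendsto_right_of_continuous hρ0 (uc i) x
    have hall : ∀ᵐ x ∂(volume : Measure (Fin Q → ℝ)), ∀ i,
        Filter.Tendsto (fun n => pd i (U n i) x) Filter.atTop (nhds (pd i (u i) x)) :=
      ae_all_iff.2 hlim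
    filter_upwards [(gaussVec_ac Q v hv).ae_le hall] with x hx
    refine Filter.Tendsto.pow ?_ 2
    exact tendsto_finsetSum _ fun i _ => ((hlim0 i x).const_mul _).sub ((hx i).const_mul _)

/-- At differentiability points of `mu`, `GSURE - SE` is a Gaussian divergence. -/
lemma integrand_eq {M Q : ℕ} (A : Matrix (Fin M) (Fin Q) ℝ) (σ : ℝ) (v : NNReal) (hvσ : (v : ℝ) = σ ^ 2)
    (mu : (Fin Q → ℝ) → (Fin Q → ℝ)) (m w : Fin Q → ℝ)
    (hd : DifferentiableAt ℝ mu (m + w)) :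
    GSURE A σ mu (m + w) - ∑ i, (A.mulVec (m - mu (m + w)) i) ^ 2
      = dvg v
          (fun i w => (Aᵀ * A).mulVec (fun k => w k - 2 * (mu (m + w) k - m k)) i) w := by
  set J := jacM mu (m + w) with hJ
  have hpd : ∀ i, pd i (fun w => (Aᵀ * A).mulVec
      (fun k => w k - 2 * (mu (m + w) k - m k)) i) w
      = (Aᵀ * A) i i - 2 * ((Aᵀ * A) * J) i i := by
    intro i
    have h1 : HasFDerivAt (fun w => mu (m + w)) (fderiv ℝ mu (m + w)) w := by
      have := hd.hasFDerivAt.comp w ((hasFDerivAt_id w).const_add m)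
      simpa using this
    have h2 : HasFDerivAt (fun w => fun k => w k - 2 * (mu (m + w) k - m k))
        (ContinuousLinearMap.id ℝ (Fin Q → ℝ) - (2:ℝ) • fderiv ℝ mu (m + w)) w := by
      have := (hasFDerivAt_id w).sub ((h1.sub_const m).const_smul (2:ℝ))
      exact this
    let T : (Fin Q → ℝ) →L[ℝ] ℝ := (ContinuousLinearMap.proj i).comp
      (LinearMap.toContinuousLinearMap (Matrix.mulVecLin (Aᵀ * A)))
    have h3 : HasFDerivAt (fun w => (Aᵀ * A).mulVec
      (fun k => w k - 2 * (mu (m + w) k - m k)) i) (T.comp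
        (ContinuousLinearMap.id ℝ (Fin Q → ℝ) - (2:ℝ) • fderiv ℝ mu (m + w))) w :=
      T.hasFDerivAt.comp w h2
    have hJc : ∀ k, J k i = fderiv ℝ mu (m + w) (Pi.single i 1) k := by
      intro k
      simp [hJ, jacM, LinearMap.toMatrix'_apply]
    unfold pd
    rw [h3.fderiv]
    have e : T.comp (ContinuousLinearMap.id ℝ (Fin Q → ℝ) - (2:ℝ) • fderiv ℝ mu (m + w))
        (Pi.single i 1) = (Aᵀ * A).mulVec (Pi.single i 1 - (2:ℝ) • (fun k => J k i)) i := by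
      have : (fun k => J k i) = fderiv ℝ mu (m + w) (Pi.single i 1) := funext hJc
      rw [this]
      rfl
    rw [e, Matrix.mulVec_sub, Matrix.mulVec_smul]
    simp only [Pi.sub_apply, Pi.smul_apply, smul_eq_mul, Matrix.mulVec_single_one,
      Matrix.mul_apply', Matrix.mulVec, Matrix.col_apply]
    rfl
  have htr : (A * J * Aᵀ).trace = (Aᵀ * A * J).trace := by
    rw [Matrix.trace_mul_comm, ← Matrix.mul_assoc]
  unfold dvg GSURE
  simp only [hpd]
  rw [← hJ, htr, hvσ]
  have hq : ∀ z : Fin M → ℝ, ∑ i, z i ^ 2 = z ⬝ᵥ z := fun z => by simp [dotProduct, sq]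
  have hw : (m + w) - mu (m + w) = w + (m - mu (m + w)) := by abel
  set g := m - mu (m + w) with hg
  have hfun : (fun k => w k - 2 * (mu (m + w) k - m k)) = w + (2:ℝ) • g := by
    funext k; simp [hg]; ring
  rw [hfun, hw, hq, hq]
  have hin : ∑ i, w i * (Aᵀ * A).mulVec (w + (2:ℝ) • g) i
      = A.mulVec w ⬝ᵥ A.mulVec (w + (2:ℝ) • g) := by
    rw [← Matrix.mulVec_mulVec]
    change w ⬝ᵥ Aᵀ.mulVec (A.mulVec (w + (2:ℝ) • g)) = _
    rw [Matrix.dotProduct_mulVec, Matrix.vecMul_transpose]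
  simp only [Finset.sum_sub_distrib, mul_sub, ← Finset.mul_sum, hin]
  simp only [Matrix.mulVec_add, Matrix.mulVec_smul, add_dotProduct, dotProduct_add,
    dotProduct_smul, smul_eq_mul, dotProduct_comm (A.mulVec g) (A.mulVec w)]
  simp only [Matrix.trace, Matrix.diag_apply, ← Finset.mul_sum]
  ring

/-- Reliability bound for the GSURE of the analysis lasso:
`E_w[(GSURE^A(y) − SE^A(y))²] ≤ σ⁴ Q² ‖A‖⁴ (18/Q + 8‖μ₀‖₂²/(σ² Q²))`. -/
theorem lasso_gsure_reliability_bound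
    {N Q P M : ℕ} (hN : 0 < N) (hQ : 0 < Q) (hP : 0 < P) (hM : 0 < M)
    (Φ : Matrix (Fin Q) (Fin N) ℝ) (D : Matrix (Fin N) (Fin P) ℝ)
    (hH0 : ∀ x : Fin N → ℝ, Φ.mulVec x = 0 → Dᵀ.mulVec x = 0 → x = 0)
    (lam : ℝ) (hlam : 0 < lam)
    (mu : (Fin Q → ℝ) → (Fin Q → ℝ))
    (hmu : ∀ y x, IsLassoSol Φ D y lam x → mu y = Φ.mulVec x)
    (K : NNReal) (hlip : LipschitzWith K mu)
    (x0 : Fin N → ℝ) (σ : ℝ) (hσ : 0 < σ)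
    (A : Matrix (Fin M) (Fin Q) ℝ)
    (μ : Measure (Fin Q → ℝ)) (hμ : μ = gaussVec Q ⟨σ ^ 2, sq_nonneg σ⟩) :
    ∫ w, (GSURE A σ mu (Φ.mulVec x0 + w)
          - ∑ i, (A.mulVec (Φ.mulVec x0 - mu (Φ.mulVec x0 + w)) i) ^ 2) ^ 2 ∂μ
      ≤ σ ^ 4 * (Q : ℝ) ^ 2 * specNorm A ^ 4 *
          (18 / (Q : ℝ)
            + 8 * (∑ i, (Φ.mulVec x0 i) ^ 2) / (σ ^ 2 * (Q : ℝ) ^ 2)) := by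
  obtain ⟨v, hvd, hvc⟩ : ∃ v : NNReal, (⟨σ ^ 2, sq_nonneg σ⟩ : NNReal) = v ∧ (v : ℝ) = σ ^ 2 :=
    ⟨_, rfl, rfl⟩
  rw [hvd] at hμ
  subst hμ
  set m := Φ.mulVec x0 with hm
  have hv : v ≠ 0 := by
    intro h
    rw [h] at hvc
    have : (0 : ℝ) < σ ^ 2 := by positivity
    simp at hvc
    exact this.ne hvc
  set u : Fin Q → (Fin Q → ℝ) → ℝ :=
    fun i w => (Aᵀ * A).mulVec (fun k => w k - 2 * (mu (m + w) k - m k)) i with hu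
  set L := specNorm A ^ 4 with hLdef
  have hL0 : 0 ≤ L := by positivity
  have hL : ∀ x y, ∑ i, (u i x - u i y) ^ 2 ≤ L * ∑ i, (x i - y i) ^ 2 := by
    intro x y
    have e : ∀ i, u i x - u i y = (Aᵀ * A).mulVec
        (fun k => ((m + x) k - 2 * mu (m + x) k) - ((m + y) k - 2 * mu (m + y) k)) i := by
      intro i
      simp only [hu]
      rw [← Pi.sub_apply, ← Matrix.mulVec_sub]
      refine congrFun (congrArg _ ?_) i
      funext k
      simp only [Pi.sub_apply, Pi.add_apply]
      ring
    simp only [e]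
    refine (specNorm_gram A _).trans (mul_le_mul_of_nonneg_left ?_ hL0)
    refine (lasso_nonexp Φ D hH0 lam hlam mu hmu (m + x) (m + y)).trans (le_of_eq ?_)
    simp
  have hG : ∀ x, ∑ i, u i x ^ 2 ≤ L * (2 * ∑ i, (m i + x i) ^ 2 + 2 * ∑ i, m i ^ 2) := by
    intro x
    refine (specNorm_gram A _).trans (mul_le_mul_of_nonneg_left ?_ hL0)
    have h0 := lasso_nonexp Φ D hH0 lam hlam mu hmu (m + x) 0
    rw [lasso_zero Φ D lam hlam mu hmu] at h0
    simp only [Pi.zero_apply, mul_zero, sub_zero, Pi.add_apply] at h0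
    have h1 : ∑ k, (x k - 2 * (mu (m + x) k - m k)) ^ 2
        ≤ 2 * ∑ k, (m k + x k - 2 * mu (m + x) k) ^ 2 + 2 * ∑ k, m k ^ 2 := by
      rw [Finset.mul_sum, Finset.mul_sum, ← Finset.sum_add_distrib]
      refine Finset.sum_le_sum fun k _ => ?_
      nlinarith [sq_nonneg ((m k + x k - 2 * mu (m + x) k) - m k)]
    linarith
  have hlipu : ∀ i, LipschitzWith (Real.toNNReal (√(L * Q))) (u i) := by
    intro i
    refine LipschitzWith.of_dist_le_mul fun x y => ?_
    rw [Real.coe_toNNReal _ (Real.sqrt_nonneg _), Real.dist_eq, dist_eq_norm]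
    have h1 : (u i x - u i y) ^ 2 ≤ L * Q * ‖x - y‖ ^ 2 := by
      have a1 : (u i x - u i y) ^ 2 ≤ ∑ i, (u i x - u i y) ^ 2 :=
        Finset.single_le_sum (f := fun i => (u i x - u i y) ^ 2)
          (fun j _ => sq_nonneg _) (Finset.mem_univ i)
      have a2 : ∑ i, (x i - y i) ^ 2 ≤ ∑ i : Fin Q, ‖x - y‖ ^ 2 := by
        refine Finset.sum_le_sum fun k _ => ?_
        rw [← sq_abs]
        exact pow_le_pow_left₀ (abs_nonneg _) (norm_le_pi_norm (x - y) k) 2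
      have a3 := mul_le_mul_of_nonneg_left a2 hL0
      simp only [Finset.sum_const, Finset.card_univ, Fintype.card_fin, nsmul_eq_mul] at a3
      linarith [hL x y]
    refine abs_le_of_sq_le_sq ?_ (by positivity) |> fun h => h
    rw [mul_pow, Real.sq_sqrt (by positivity)]
    exact h1
  have hae : ∀ᵐ w ∂(gaussVec Q v), DifferentiableAt ℝ mu (m + w) := by
    have h1 : ∀ᵐ y ∂(volume : Measure (Fin Q → ℝ)), DifferentiableAt ℝ mu y :=
      hlip.ae_differentiableAt
    have h2 : ∀ᵐ w ∂(volume : Measure (Fin Q → ℝ)), DifferentiableAt ℝ mu (m + w) :=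
      (measurePreserving_add_left volume m).quasiMeasurePreserving.ae h1
    exact (gaussVec_ac Q _ hv).ae_le h2
  have key := dvg_bound _ hv u _ hlipu L hL0 m hL hG
  rw [integral_congr_ae (g := fun w => (dvg v u w) ^ 2)]
  · refine key.trans ?_
    have hQ' : (0:ℝ) < Q := by exact_mod_cast hQ
    have hS0 : 0 ≤ ∑ i, m i ^ 2 := Finset.sum_nonneg fun i _ => sq_nonneg _
    rw [hvc]
    have e : σ ^ 4 * (Q : ℝ) ^ 2 * L * (18 / (Q : ℝ)
            + 8 * (∑ i, m i ^ 2) / (σ ^ 2 * (Q : ℝ) ^ 2))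
        = L * (18 * Q * (σ ^ 2) ^ 2 + 8 * σ ^ 2 * ∑ i, m i ^ 2) := by
      field_simp
    rw [e]
    refine mul_le_mul_of_nonneg_left ?_ hL0
    have h1 : 0 ≤ (Q:ℝ) * (σ ^ 2) ^ 2 := by positivity
    have h2 : 0 ≤ σ ^ 2 * ∑ i, m i ^ 2 := by positivity
    linarith
  · filter_upwards [hae] with w hw
    have := integrand_eq A σ v hvc mu m w hw
    exact congrArg (fun z => z ^ 2) this
end
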